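/- arXiv:2205.10799 — 7 statements merged into one kernel-verified Lean document; each statement's English description precedes it below -/
import Mathlib

section
/- Let n ≥ 1 be an integer and let s : (0,∞)² → ℝ be Borel measurable such that ∫₀^∞ ∫₀^∞ |s(x,y)| e^{−λx−αy} x^{nα−1} dy dx < ∞ for all α > 0 and λ > 0. Then the function H(α,λ) := ∫₀^∞ ∫₀^∞ s(x,y) e^{−λx−αy} x^{nα−1} dy dx is continuous on (0,∞)². -/
open MeasureTheory Set

/-- On `(0,∞)`, real powers with exponent in `[0, m]` are uniformly dominated by an exponential. -/
lemma rpow_le_const_mul_exp {c x t : ℝ} (hc : 0 < c) (hx : 0 < x) (ht : 0 ≤ t) {m : ℕ}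
    (htm : t ≤ m) :
    x ^ t ≤ (m.factorial / c ^ m * Real.exp c) * Real.exp (c * x) := by
  have h1 : x ^ t ≤ (1 + x) ^ m := by
    calc x ^ t ≤ (1 + x) ^ t := Real.rpow_le_rpow hx.le (by linarith) ht
      _ ≤ (1 + x) ^ (m : ℝ) := Real.rpow_le_rpow_of_exponent_le (by linarith) htm
      _ = (1 + x) ^ m := Real.rpow_natCast _ _
  have h2 := Real.pow_div_factorial_le_exp (c * (1 + x)) (by positivity) m
  have hm : (0 : ℝ) < m.factorial := by positivity
  rw [div_le_iff₀ hm, mul_pow] at h2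
  rw [mul_assoc, ← Real.exp_add, div_mul_eq_mul_div, show c + c * x = c * (1 + x) by ring]
  refine h1.trans ?_
  rw [le_div_iff₀ (by positivity)]
  linarith

/-- Continuity in `(α, λ)` of the double integral
`H(α,λ) = ∫₀^∞ ∫₀^∞ s(x,y) e^{−λx−αy} x^{nα−1} dy dx`. -/
theorem continuity_of_H
    (n : ℕ) (hn : 1 ≤ n) (s : ℝ → ℝ → ℝ)
    (hs : Measurable (Function.uncurry s))
    (hint : ∀ a > (0:ℝ), ∀ l > (0:ℝ),
      IntegrableOn (fun p : ℝ × ℝ =>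
          |s p.1 p.2| * Real.exp (-l * p.1 - a * p.2) * p.1 ^ ((n : ℝ) * a - 1))
        ((Ioi 0) ×ˢ (Ioi 0))) :
    ContinuousOn (fun q : ℝ × ℝ =>
        ∫ p in (Ioi (0:ℝ)) ×ˢ (Ioi (0:ℝ)),
          s p.1 p.2 * Real.exp (-q.2 * p.1 - q.1 * p.2) * p.1 ^ ((n : ℝ) * q.1 - 1))
      ((Ioi 0) ×ˢ (Ioi 0)) := by
  rintro ⟨a, l⟩ ⟨ha, hl⟩
  simp only [mem_Ioi] at ha hl
  apply ContinuousAt.continuousWithinAt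
  obtain ⟨m, hm⟩ := exists_nat_ge ((n : ℝ) * (2 * a))
  have hs' : Measurable fun p : ℝ × ℝ => s p.1 p.2 := hs
  have hS : MeasurableSet (Ioi (0 : ℝ) ×ˢ Ioi (0 : ℝ)) := measurableSet_Ioi.prod measurableSet_Ioi
  refine continuousAt_of_dominated
    (bound := fun p : ℝ × ℝ => (m.factorial / (l / 4) ^ m * Real.exp (l / 4)) *
      (|s p.1 p.2| * Real.exp (-(l / 4) * p.1 - (a / 2) * p.2) *
        p.1 ^ ((n : ℝ) * (a / 2) - 1))) ?_ ?_ ?_ ?_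
  · exact .of_forall fun q => Measurable.aestronglyMeasurable (by fun_prop)
  · have hU : Ioo (a / 2) (2 * a) ×ˢ Ioi (l / 2) ∈ nhds (a, l) :=
      prod_mem_nhds (Ioo_mem_nhds (by linarith) (by linarith)) (Ioi_mem_nhds (by linarith))
    filter_upwards [hU]
    rintro ⟨b, k⟩ ⟨⟨hb1, hb2⟩, hk⟩
    simp only [mem_Ioi] at hb1 hb2 hk
    filter_upwards [ae_restrict_mem hS]
    rintro ⟨x, y⟩ ⟨hx, hy⟩
    simp only [mem_Ioi] at hx hy
    have hn0 : (0 : ℝ) ≤ n := n.cast_nonneg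
    have hpow : x ^ ((n : ℝ) * b - 1) =
        x ^ ((n : ℝ) * (b - a / 2)) * x ^ ((n : ℝ) * (a / 2) - 1) := by
      rw [← Real.rpow_add hx]; ring_nf
    have hbound := rpow_le_const_mul_exp (c := l / 4) (t := (n : ℝ) * (b - a / 2)) (m := m)
      (by linarith) hx (mul_nonneg hn0 (by linarith))
      ((mul_le_mul_of_nonneg_left (by linarith) hn0).trans hm)
    have hexp : Real.exp (-k * x - b * y) * Real.exp (l / 4 * x) ≤
        Real.exp (-(l / 4) * x - a / 2 * y) := by
      rw [← Real.exp_add, Real.exp_le_exp]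
      nlinarith [mul_pos (sub_pos.2 hk) hx, mul_pos (sub_pos.2 hb1) hy]
    rw [norm_mul, norm_mul, Real.norm_eq_abs, Real.norm_of_nonneg (Real.exp_nonneg _),
      Real.norm_of_nonneg (Real.rpow_nonneg hx.le _), hpow]
    set C : ℝ := m.factorial / (l / 4) ^ m * Real.exp (l / 4)
    have hC : 0 ≤ C := by positivity
    calc |s x y| * Real.exp (-k * x - b * y) *
          (x ^ ((n : ℝ) * (b - a / 2)) * x ^ ((n : ℝ) * (a / 2) - 1))
        ≤ |s x y| * Real.exp (-k * x - b * y) *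
          (C * Real.exp (l / 4 * x) * x ^ ((n : ℝ) * (a / 2) - 1)) := by gcongr
      _ = C * (|s x y| * (Real.exp (-k * x - b * y) * Real.exp (l / 4 * x)) *
          x ^ ((n : ℝ) * (a / 2) - 1)) := by ring
      _ ≤ _ := by gcongr
  · exact (hint (a / 2) (by positivity) (l / 4) (by positivity)).const_mul _
  · filter_upwards [ae_restrict_mem hS]
    rintro ⟨x, y⟩ ⟨hx, -⟩
    have hx0 : x ≠ 0 := ne_of_gt hx
    refine ContinuousAt.mul (by fun_prop) ?_
    exact ContinuousAt.rpow continuousAt_const (by fun_prop) (Or.inl hx0)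
end

section
/- Let n ≥ 2 and set c = (n−3)/2. Let h : (0,∞) → ℝ and U : (0,∞)×(0,1) → ℝ be Borel measurable, and assume that for all α > 0 and λ > 0: (i) ∫₀^∞ ∫₀¹ x^{nα−1} e^{−λx} y^{α−1} (1−y)^c G(y) |U(x,y)| dy dx < ∞, and (ii) λ^{nα} · ∫₀^∞ ∫₀¹ x^{nα−1} e^{−λx} y^{α−1} (1−y)^c G(y) U(x,y) dy dx = Γ(nα) · h(α) · ∫₀¹ y^{α−1} (1−y)^c G(y) dy. Then h is continuous on (0,∞), and there exists a Borel measurable function u : (0,1) → ℝ such that for every α > 0, ∫₀¹ y^{α−1} (1−y)^c G(y) |u(y)| dy < ∞ and ∫₀¹ y^{α−1} (1−y)^c G(y) u(y) dy = h(α) · ∫₀¹ y^{α−1} (1−y)^c G(y) dy. -/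
open MeasureTheory Set

/-- The recursively defined coefficients `γ_i(m)` from the paper (depending on `n`). -/
noncomputable def gammaCoeff (n : ℕ) : ℕ → ℕ → ℝ
  | 0, _ => 0
  | 1, m => if m = 0 then 1 else 0
  | (i + 2), m =>
      (Real.Gamma ((m : ℝ) + ((i : ℝ) + 1) * ((i : ℝ) + 2) / (2 * (n : ℝ))) /
        Real.Gamma ((m : ℝ) + ((i : ℝ) + 2) * ((i : ℝ) + 3) / (2 * (n : ℝ)))) *
      ∑ k ∈ Finset.range (m + 1),
        (Real.Gamma (((m - k : ℕ) : ℝ) + ((i : ℝ) + 2) / (n : ℝ)) /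
          (Nat.factorial (m - k) : ℝ)) * gammaCoeff n (i + 1) k

/-- `d_m = γ_{n−1}(m)`. -/
noncomputable def dCoeff (n : ℕ) (m : ℕ) : ℝ := gammaCoeff n (n - 1) m

/-- `G(y) = Σ_{m≥0} d_m (1−y)^m`. -/
noncomputable def Gfun (n : ℕ) (y : ℝ) : ℝ := ∑' m : ℕ, dCoeff n m * (1 - y) ^ m

theorem Gamma_nat_add_div_factorial_le {p : ℝ} (hp : 0 < p) (hp1 : p < 1) :
    ∃ C, ∀ m : ℕ, Real.Gamma (m + p) / (m.factorial : ℝ) ≤ C * ((m : ℝ) + 1) ^ (p - 1) := by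
  refine ⟨1 / p, fun m => ?_⟩
  have hm : (0 : ℝ) ≤ m := m.cast_nonneg
  have h1 := Real.Gamma_mul_add_mul_le_rpow_Gamma_mul_rpow_Gamma (s := (m : ℝ) + 1)
    (t := (m : ℝ) + 2) (a := 1 - p) (b := p) (by positivity) (by positivity) (by linarith) hp
    (by ring)
  have e1 : (1 - p) * ((m : ℝ) + 1) + p * ((m : ℝ) + 2) = (m + p) + 1 := by ring
  have e2 : Real.Gamma ((m : ℝ) + 2) = (m + 1) * m.factorial := by
    rw [show (m : ℝ) + 2 = (m + 1) + 1 by ring, Real.Gamma_add_one (by positivity),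
      Real.Gamma_nat_eq_factorial]
  have hfac : (0 : ℝ) < m.factorial := by positivity
  rw [e1, e2, Real.Gamma_nat_eq_factorial, Real.Gamma_add_one (by positivity),
    Real.mul_rpow (by positivity) hfac.le, mul_left_comm, ← Real.rpow_add hfac,
    sub_add_cancel, Real.rpow_one] at h1
  rw [div_le_iff₀ hfac, Real.rpow_sub_one (by positivity)]
  have h2 : Real.Gamma (m + p) ≤ ((m : ℝ) + 1) ^ p * m.factorial / (m + p) := by
    rw [le_div_iff₀ (by positivity)]; linarith
  refine h2.trans ?_
  have h3 : 1 / (m + p) ≤ 1 / p * (1 / ((m : ℝ) + 1)) := by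
    rw [div_mul_div_comm, div_le_div_iff₀ (by positivity) (by positivity)]
    nlinarith
  calc ((m : ℝ) + 1) ^ p * m.factorial / (m + p)
      = ((m : ℝ) + 1) ^ p * m.factorial * (1 / (m + p)) := by ring
    _ ≤ ((m : ℝ) + 1) ^ p * m.factorial * (1 / p * (1 / ((m : ℝ) + 1))) := by gcongr
    _ = _ := by ring

theorem Gamma_div_Gamma_add_le {p x : ℝ} (hp : 0 < p) (hp1 : p < 1) (hx : 0 < x) :
    ∃ C, ∀ m : ℕ, Real.Gamma (m + x) / Real.Gamma (m + (x + p)) ≤ C * ((m : ℝ) + 1) ^ (-p) := by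
  refine ⟨(x + p + 1) ^ (1 - p) * (1 + 1 / x), fun m => ?_⟩
  have hm : (0 : ℝ) ≤ m := m.cast_nonneg
  have h1 := Real.Gamma_mul_add_mul_le_rpow_Gamma_mul_rpow_Gamma (s := (m : ℝ) + (x + p))
    (t := (m : ℝ) + (x + p) + 1) (a := p) (b := 1 - p) (by positivity) (by positivity) hp
    (by linarith) (by ring)
  have hG : 0 < Real.Gamma (m + (x + p)) := Real.Gamma_pos_of_pos (by positivity)
  rw [show p * ((m : ℝ) + (x + p)) + (1 - p) * ((m : ℝ) + (x + p) + 1) = (m + x) + 1 by ring,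
    Real.Gamma_add_one (by positivity), Real.Gamma_add_one (by positivity),
    Real.mul_rpow (by positivity) hG.le, mul_left_comm, ← Real.rpow_add hG,
    add_sub_cancel, Real.rpow_one] at h1
  have h2 : Real.Gamma (m + x) / Real.Gamma (m + (x + p))
      ≤ ((m : ℝ) + (x + p)) ^ (1 - p) * (1 / (m + x)) := by
    rw [mul_one_div, div_le_div_iff₀ hG (by positivity)]; linarith
  refine h2.trans ?_
  have h3 : ((m : ℝ) + (x + p)) ^ (1 - p) ≤ (x + p + 1) ^ (1 - p) * ((m : ℝ) + 1) ^ (1 - p) := by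
    rw [← Real.mul_rpow (by positivity) (by positivity)]
    refine Real.rpow_le_rpow (by positivity) ?_ (by linarith)
    nlinarith [mul_nonneg hm (add_pos hx hp).le]
  have h4 : 1 / (m + x) ≤ (1 + 1 / x) * (1 / ((m : ℝ) + 1)) := by
    rw [show 1 + 1 / x = (x + 1) / x by field_simp, div_mul_div_comm,
      div_le_div_iff₀ (by positivity) (by positivity)]
    nlinarith [mul_nonneg hm hx.le]
  calc _ ≤ ((x + p + 1) ^ (1 - p) * ((m : ℝ) + 1) ^ (1 - p)) *
        ((1 + 1 / x) * (1 / ((m : ℝ) + 1))) := by gcongr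
    _ = _ := by
      rw [show (1 - p) = -p + 1 by ring, Real.rpow_add_one (x := (m : ℝ) + 1) (by positivity)]
      field_simp

theorem rpow_convolution_bound {p a x y : ℝ} (hp : 0 ≤ p) (ha : 0 ≤ a) (hx : 0 ≤ x)
    (hy : 0 ≤ y) :
    (x + y + 1) ^ (-a) * ((x + y + 1) ^ (-p) * (x + 1) ^ (p - 1)) ≤
      (y + 1) ^ (-(a / 2)) * (x + 1) ^ (-1 - a / 2) := by
  have h1 : (x + y + 1) ^ (-a) * (x + y + 1) ^ (-p) =
      (x + y + 1) ^ (-(a / 2)) * (x + y + 1) ^ (-(p + a / 2)) := by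
    rw [← Real.rpow_add (by positivity), ← Real.rpow_add (by positivity)]
    congr 1; ring
  rw [← mul_assoc, h1, show -1 - a / 2 = -(p + a / 2) + (p - 1) by ring,
    Real.rpow_add (x := x + 1) (by positivity), ← mul_assoc]
  have h2 : (x + y + 1) ^ (-(a / 2)) ≤ (y + 1) ^ (-(a / 2)) :=
    Real.rpow_le_rpow_of_nonpos (by positivity) (by linarith) (by linarith)
  have h3 : (x + y + 1) ^ (-(p + a / 2)) ≤ (x + 1) ^ (-(p + a / 2)) :=
    Real.rpow_le_rpow_of_nonpos (by positivity) (by linarith) (by linarith)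
  gcongr

theorem gammaCoeff_nonneg (n i m : ℕ) : 0 ≤ gammaCoeff n i m := by
  induction i generalizing m with
  | zero => simp [gammaCoeff]
  | succ i ih =>
    cases i with
    | zero => simp only [gammaCoeff]; split_ifs <;> simp
    | succ i =>
      rw [gammaCoeff]
      have hG : ∀ x : ℝ, 0 ≤ x → 0 ≤ Real.Gamma x := fun x hx => Real.Gamma_nonneg_of_nonneg hx
      refine mul_nonneg (div_nonneg (hG _ (by positivity)) (hG _ (by positivity))) ?_
      exact Finset.sum_nonneg fun k _ =>
        mul_nonneg (div_nonneg (hG _ (by positivity)) (by positivity)) (ih k)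

theorem gammaCoeff_zero_pos {n : ℕ} (hn : 2 ≤ n) (i : ℕ) : 0 < gammaCoeff n (i + 1) 0 := by
  have hn0 : (0 : ℝ) < n := by positivity
  induction i with
  | zero => simp [gammaCoeff]
  | succ i ih =>
    rw [gammaCoeff]
    have hG : ∀ x : ℝ, 0 < x → 0 < Real.Gamma x := fun x hx => Real.Gamma_pos_of_pos hx
    refine mul_pos (div_pos (hG _ (by positivity)) (hG _ (by positivity))) ?_
    simp only [zero_add, Finset.sum_range_one]
    exact mul_pos (div_pos (hG _ (by positivity)) (by positivity)) ih

theorem summable_gammaCoeff_mul_rpow {n i : ℕ} (hi : i + 1 < n) {a : ℝ} (ha : 0 < a) :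
    Summable fun m : ℕ => gammaCoeff n (i + 1) m * ((m : ℝ) + 1) ^ (-a) := by
  induction i generalizing a with
  | zero =>
    refine summable_of_ne_finset_zero (s := {0}) fun m hm => ?_
    rw [Finset.mem_singleton] at hm
    simp [gammaCoeff, hm]
  | succ i ih =>
    have hn : (0 : ℝ) < n := by exact_mod_cast (by lia : 0 < n)
    set p : ℝ := ((i : ℝ) + 2) / n with hpdef
    have hp : 0 < p := by positivity
    have hp1 : p < 1 := by
      rw [hpdef, div_lt_one hn]; exact_mod_cast hi
    set x : ℝ := ((i : ℝ) + 1) * ((i : ℝ) + 2) / (2 * (n : ℝ)) with hxdef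
    have hx : 0 < x := by positivity
    have hxp : ((i : ℝ) + 2) * ((i : ℝ) + 3) / (2 * (n : ℝ)) = x + p := by
      rw [hxdef, hpdef]; field_simp; ring
    obtain ⟨C, hC⟩ := Gamma_nat_add_div_factorial_le hp hp1
    obtain ⟨D, hD⟩ := Gamma_div_Gamma_add_le hp hp1 hx
    have hD0 : 0 ≤ D := by
      have := hD 0
      simp only [Nat.cast_zero, zero_add, Real.one_rpow, mul_one] at this
      exact (div_pos (Real.Gamma_pos_of_pos hx) (Real.Gamma_pos_of_pos (by positivity))).le.trans
        this
    have hC0 : 0 ≤ C := by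
      have := hC 0
      simp only [Nat.cast_zero, zero_add, Real.one_rpow, mul_one, Nat.factorial_zero,
        Nat.cast_one, div_one] at this
      exact (Real.Gamma_pos_of_pos hp).le.trans this
    have hA := ih (by lia) (a := a / 2) (by positivity)
    have hB : Summable fun j : ℕ => ((j : ℝ) + 1) ^ (-1 - a / 2) := by
      have := (summable_nat_add_iff 1).2
        (Real.summable_nat_rpow.2 (show -1 - a / 2 < -1 by linarith))
      simpa using this
    have hconv := (summable_norm_sum_mul_range_of_summable_norm hA.norm hB.norm).of_norm
    refine Summable.of_nonneg_of_le (fun m => mul_nonneg (gammaCoeff_nonneg _ _ _) (by positivity))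
      (fun m => ?_) (hconv.mul_left (D * C))
    rw [gammaCoeff, hxp]
    have hS : ∀ k ∈ Finset.range (m + 1),
        Real.Gamma (((m - k : ℕ) : ℝ) + p) / (Nat.factorial (m - k) : ℝ) * gammaCoeff n (i + 1) k
          ≤ C * (((m - k : ℕ) : ℝ) + 1) ^ (p - 1) * gammaCoeff n (i + 1) k := fun k _ =>
      mul_le_mul_of_nonneg_right (hC _) (gammaCoeff_nonneg _ _ _)
    have hS0 : 0 ≤ ∑ k ∈ Finset.range (m + 1),
        C * (((m - k : ℕ) : ℝ) + 1) ^ (p - 1) * gammaCoeff n (i + 1) k :=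
      Finset.sum_nonneg fun k _ => mul_nonneg (by positivity) (gammaCoeff_nonneg _ _ _)
    calc _ ≤ (D * ((m : ℝ) + 1) ^ (-p) * ∑ k ∈ Finset.range (m + 1),
          C * (((m - k : ℕ) : ℝ) + 1) ^ (p - 1) * gammaCoeff n (i + 1) k) *
            ((m : ℝ) + 1) ^ (-a) := by
          refine mul_le_mul_of_nonneg_right ?_ (by positivity)
          refine (mul_le_mul_of_nonneg_left (Finset.sum_le_sum hS)
            (div_nonneg (Real.Gamma_nonneg_of_nonneg (by positivity))
              (Real.Gamma_nonneg_of_nonneg (by positivity)))).trans ?_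
          exact mul_le_mul_of_nonneg_right (hD m) hS0
      _ = D * C * ∑ k ∈ Finset.range (m + 1), gammaCoeff n (i + 1) k *
            (((m : ℝ) + 1) ^ (-a) * (((m : ℝ) + 1) ^ (-p) *
              (((m - k : ℕ) : ℝ) + 1) ^ (p - 1))) := by
          simp only [Finset.mul_sum, Finset.sum_mul]
          exact Finset.sum_congr rfl fun k _ => by ring
      _ ≤ _ := by
          refine mul_le_mul_of_nonneg_left (Finset.sum_le_sum fun k hk => ?_) (by positivity)
          rw [mul_assoc]
          refine mul_le_mul_of_nonneg_left ?_ (gammaCoeff_nonneg _ _ _)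
          have hkm : k ≤ m := Nat.lt_succ_iff.1 (Finset.mem_range.1 hk)
          have := rpow_convolution_bound (x := ((m - k : ℕ) : ℝ)) (y := (k : ℝ)) hp.le ha.le
            (Nat.cast_nonneg _) (Nat.cast_nonneg _)
          rwa [show ((m - k : ℕ) : ℝ) + (k : ℝ) = m by
            rw [← Nat.cast_add, Nat.sub_add_cancel hkm]] at this

theorem summable_dCoeff_mul_rpow {n : ℕ} (hn : 2 ≤ n) {a : ℝ} (ha : 0 < a) :
    Summable fun m : ℕ => dCoeff n m * ((m : ℝ) + 1) ^ (-a) := by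
  obtain ⟨i, rfl⟩ : ∃ i, n = i + 2 := ⟨n - 2, by lia⟩
  exact summable_gammaCoeff_mul_rpow (by lia) ha

theorem one_sub_pow_le_rpow {e y : ℝ} (he : 0 < e) (he1 : e ≤ 1) (hy : y ∈ Ioo (0 : ℝ) 1) (m : ℕ) :
    (1 - y) ^ m ≤ Real.exp 1 * y ^ (-e) * ((m : ℝ) + 1) ^ (-e) := by
  obtain ⟨hy0, hy1⟩ := hy
  set s : ℝ := ((m : ℝ) + 1) * y with hs
  have hs0 : 0 < s := by positivity
  have h1 : (1 - y) ^ m ≤ Real.exp (-(m * y)) := by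
    rw [← mul_neg, Real.exp_nat_mul]
    exact pow_le_pow_left₀ (by linarith) (Real.one_sub_le_exp_neg y) m
  have h2 : Real.exp (-(m * y)) ≤ Real.exp 1 * Real.exp (-s) := by
    rw [← Real.exp_add]
    exact Real.exp_le_exp.2 (by rw [hs]; linarith)
  have h3 : Real.exp (-s) ≤ s ^ (-e) := by
    rw [Real.exp_neg, Real.rpow_neg hs0.le]
    refine inv_anti₀ (by positivity) ?_
    rcases le_total 1 s with h | h
    · calc s ^ e ≤ s ^ (1 : ℝ) := Real.rpow_le_rpow_of_exponent_le h he1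
        _ = s := Real.rpow_one s
        _ ≤ _ := by linarith [Real.add_one_le_exp s]
    · exact (Real.rpow_le_one hs0.le h he.le).trans (Real.one_le_exp hs0.le)
  have h4 : s ^ (-e) = y ^ (-e) * ((m : ℝ) + 1) ^ (-e) := by
    rw [hs, Real.mul_rpow (by positivity) hy0.le, mul_comm]
  rw [mul_assoc, ← h4]
  exact h1.trans (h2.trans (mul_le_mul_of_nonneg_left h3 (by positivity)))

theorem dCoeff_nonneg (n m : ℕ) : 0 ≤ dCoeff n m := gammaCoeff_nonneg _ _ _

theorem summable_Gfun {n : ℕ} (hn : 2 ≤ n) {y : ℝ} (hy : y ∈ Ioo (0 : ℝ) 1) :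
    Summable fun m : ℕ => dCoeff n m * (1 - y) ^ m := by
  refine Summable.of_nonneg_of_le
    (fun m => mul_nonneg (dCoeff_nonneg n m) (pow_nonneg (by linarith [hy.2]) m)) (fun m => ?_)
    ((summable_dCoeff_mul_rpow hn one_pos).mul_left (Real.exp 1 * y ^ (-1 : ℝ)))
  rw [mul_left_comm]
  exact mul_le_mul_of_nonneg_left (one_sub_pow_le_rpow one_pos le_rfl hy m) (dCoeff_nonneg n m)

theorem Gfun_pos {n : ℕ} (hn : 2 ≤ n) {y : ℝ} (hy : y ∈ Ioo (0 : ℝ) 1) : 0 < Gfun n y := by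
  refine (summable_Gfun hn hy).tsum_pos
    (fun m => mul_nonneg (dCoeff_nonneg n m) (pow_nonneg (by linarith [hy.2]) m)) 0 ?_
  obtain ⟨i, rfl⟩ : ∃ i, n = i + 2 := ⟨n - 2, by lia⟩
  simpa [dCoeff] using gammaCoeff_zero_pos hn i

theorem Gfun_le {n : ℕ} (hn : 2 ≤ n) {e : ℝ} (he : 0 < e) (he1 : e ≤ 1) :
    ∃ C, ∀ y ∈ Ioo (0 : ℝ) 1, Gfun n y ≤ C * y ^ (-e) := by
  refine ⟨Real.exp 1 * ∑' m : ℕ, dCoeff n m * ((m : ℝ) + 1) ^ (-e), fun y hy => ?_⟩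
  have hs := (summable_dCoeff_mul_rpow hn he).mul_left (Real.exp 1 * y ^ (-e))
  have : Gfun n y ≤ ∑' m : ℕ, Real.exp 1 * y ^ (-e) * (dCoeff n m * ((m : ℝ) + 1) ^ (-e)) := by
    refine (summable_Gfun hn hy).tsum_le_tsum (fun m => ?_) hs
    rw [mul_left_comm]
    exact mul_le_mul_of_nonneg_left (one_sub_pow_le_rpow he he1 hy m) (dCoeff_nonneg n m)
  rw [tsum_mul_left] at this
  linarith

theorem measurable_Gfun (n : ℕ) : Measurable (Gfun n) :=
  Measurable.tsum fun _ => by fun_prop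

theorem integrableOn_rpow_mul_one_sub_rpow {u v : ℝ} (hu : 0 < u) (hv : 0 < v) :
    IntegrableOn (fun y : ℝ => y ^ (u - 1) * (1 - y) ^ (v - 1)) (Ioo 0 1) := by
  have h := Complex.betaIntegral_convergent (u := u) (v := v) (by simpa) (by simpa)
  rw [intervalIntegrable_iff_integrableOn_Ioo_of_le zero_le_one] at h
  refine h.norm.congr (ae_restrict_of_forall_mem measurableSet_Ioo fun y hy => ?_)
  have h1 : (1 : ℂ) - y = ((1 - y : ℝ) : ℂ) := by push_cast; rfl
  beta_reduce
  rw [norm_mul, h1, Complex.norm_cpow_eq_rpow_re_of_pos hy.1,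
    Complex.norm_cpow_eq_rpow_re_of_pos (sub_pos.2 hy.2)]
  simp

theorem integrableOn_rpow_mul_Gfun {n : ℕ} (hn : 2 ≤ n) {a : ℝ} (ha : 0 < a) :
    IntegrableOn (fun y : ℝ => y ^ (a - 1) * ((1 - y) ^ (((n : ℝ) - 3) / 2) * Gfun n y))
      (Ioo 0 1) := by
  have hn2 : (2 : ℝ) ≤ n := by exact_mod_cast hn
  have he : 0 < min (a / 2) 1 := by positivity
  obtain ⟨C, hC⟩ := Gfun_le hn he (min_le_right _ _)
  have hint := (integrableOn_rpow_mul_one_sub_rpow (u := a - min (a / 2) 1)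
    (v := ((n : ℝ) - 3) / 2 + 1) (by linarith [min_le_left (a / 2) 1]) (by linarith)).const_mul C
  refine Integrable.mono' hint ?_ (ae_restrict_of_forall_mem measurableSet_Ioo fun y hy => ?_)
  · exact Measurable.aestronglyMeasurable
      ((measurable_id.pow_const _).mul (((measurable_const.sub measurable_id).pow_const _).mul
        (measurable_Gfun n)))
  · have hy1 : 0 < 1 - y := sub_pos.2 hy.2
    have hy0 : 0 < y := hy.1
    have hG := Gfun_pos hn hy
    rw [Real.norm_of_nonneg (by positivity)]
    calc _ ≤ y ^ (a - 1) * ((1 - y) ^ (((n : ℝ) - 3) / 2) * (C * y ^ (-min (a / 2) 1))) := by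
          gcongr; exact hC y hy
      _ = _ := by
          rw [add_sub_cancel_right, show a - min (a / 2) 1 - 1 = (a - 1) + -min (a / 2) 1 by ring,
            Real.rpow_add hy0]
          ring

/-- A function on the half line whose Laplace transform vanishes at every positive integer is zero
almost everywhere. -/
theorem ae_eq_zero_of_laplace_eq_zero {f : ℝ → ℝ}
    (hf : ∀ k : ℕ, IntegrableOn (fun x => Real.exp (-((k : ℝ) + 1) * x) * f x) (Ioi 0))
    (h0 : ∀ k : ℕ, ∫ x in Ioi (0 : ℝ), Real.exp (-((k : ℝ) + 1) * x) * f x = 0) :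
    ∀ᵐ x ∂volume.restrict (Ioi (0 : ℝ)), f x = 0 := by
  have hF : IntegrableOn (fun x => Real.exp (-x) * f x) (Ioi 0) := by simpa using hf 0
  have key : ∀ᵐ x ∂volume, x ∈ Ioi (0 : ℝ) → Real.exp (-x) * f x = 0 := by
    refine isOpen_Ioi.ae_eq_zero_of_integral_contDiff_smul_eq_zero hF.locallyIntegrableOn ?_
    intro g hg hgc hgs
    have hgcont : Continuous g := hg.continuous
    have hres : ∫ x, g x • (Real.exp (-x) * f x)
        = ∫ x in Ioi (0 : ℝ), g x * (Real.exp (-x) * f x) := by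
      symm
      refine setIntegral_eq_integral_of_forall_compl_eq_zero fun x hx => ?_
      rw [image_eq_zero_of_notMem_tsupport fun h => hx (hgs h), zero_mul]
    rw [hres]
    have hkc : ContinuousOn (fun t : ℝ => g (-Real.log t)) (Icc 0 1) := by
      obtain ⟨R, hR⟩ := hgc.isBounded.subset_closedBall 0
      intro t ht
      rcases eq_or_ne t 0 with rfl | ht0
      · have hev : (fun t : ℝ => g (-Real.log t)) =ᶠ[nhds 0] fun _ => 0 := by
          have : Iio (Real.exp (-|R| - 1)) ∈ nhds (0 : ℝ) := Iio_mem_nhds (Real.exp_pos _)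
          have h2 : Ioi (-Real.exp (-|R| - 1)) ∈ nhds (0 : ℝ) :=
            Ioi_mem_nhds (neg_lt_zero.2 (Real.exp_pos _))
          filter_upwards [this, h2] with s hs hs2
          refine image_eq_zero_of_notMem_tsupport fun h => ?_
          rcases eq_or_ne s 0 with rfl | hs0
          · have := hgs h
            simp at this
          · have h3 : Real.log |s| < -|R| - 1 := by
              rw [Real.log_lt_iff_lt_exp (abs_pos.2 hs0)]
              exact abs_lt.2 ⟨hs2, hs⟩
            have h4 := hR h
            rw [mem_closedBall_zero_iff, Real.norm_eq_abs, abs_neg] at h4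
            rw [Real.log_abs] at h3
            have := neg_abs_le (Real.log s)
            have := le_abs_self R
            linarith
        have h00 : g (-Real.log 0) = 0 := hev.eq_of_nhds
        refine ContinuousAt.continuousWithinAt ?_
        exact (continuousAt_const (y := (0 : ℝ))).congr hev.symm
      · exact (hgcont.continuousAt.comp
          (Real.continuousAt_log ht0).neg).continuousWithinAt
    have hpoly : ∀ p : Polynomial ℝ,
        IntegrableOn (fun x => p.eval (Real.exp (-x)) * (Real.exp (-x) * f x)) (Ioi 0) ∧
        ∫ x in Ioi (0 : ℝ), p.eval (Real.exp (-x)) * (Real.exp (-x) * f x) = 0 := by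
      intro p
      have hexp : (fun x => p.eval (Real.exp (-x)) * (Real.exp (-x) * f x)) = fun x =>
          ∑ i ∈ Finset.range (p.natDegree + 1),
            p.coeff i * (Real.exp (-((i : ℝ) + 1) * x) * f x) := by
        funext x
        rw [Polynomial.eval_eq_sum_range, Finset.sum_mul]
        refine Finset.sum_congr rfl fun i _ => ?_
        rw [← Real.exp_nat_mul, show -((i : ℝ) + 1) * x = i * -x + -x by ring, Real.exp_add]
        ring
      rw [hexp]
      refine ⟨integrable_finsetSum _ fun i _ => (hf i).const_mul _, ?_⟩
      rw [integral_finsetSum _ fun i _ => (hf i).const_mul _]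
      simp only [integral_const_mul, h0, mul_zero, Finset.sum_const_zero]
    set M := ∫ x in Ioi (0 : ℝ), |Real.exp (-x) * f x| with hM
    have hM0 : 0 ≤ M := integral_nonneg fun _ => abs_nonneg _
    have hgint : IntegrableOn (fun x => g x * (Real.exp (-x) * f x)) (Ioi 0) := by
      obtain ⟨C, hC⟩ := hgcont.bounded_above_of_compact_support hgc
      exact Integrable.bdd_mul (c := C) hF hgcont.aestronglyMeasurable (Filter.Eventually.of_forall hC)
    have hbound : ∀ ε > 0, |∫ x in Ioi (0 : ℝ), g x * (Real.exp (-x) * f x)| ≤ ε * M := by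
      intro ε hε
      obtain ⟨p, hp⟩ := exists_polynomial_near_of_continuousOn 0 1 _ hkc ε hε
      have : ∫ x in Ioi (0 : ℝ), g x * (Real.exp (-x) * f x) =
          ∫ x in Ioi (0 : ℝ), (g x * (Real.exp (-x) * f x)
            - p.eval (Real.exp (-x)) * (Real.exp (-x) * f x)) := by
        rw [integral_sub hgint (hpoly p).1, (hpoly p).2, sub_zero]
      rw [this, hM, ← integral_const_mul, ← Real.norm_eq_abs]
      refine norm_integral_le_of_norm_le (hF.norm.const_mul ε) ?_
      refine ae_restrict_of_forall_mem measurableSet_Ioi fun x hx => ?_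
      rw [← sub_mul, norm_mul]
      refine mul_le_mul_of_nonneg_right ?_ (norm_nonneg _)
      have := hp (Real.exp (-x))
        ⟨(Real.exp_pos _).le, Real.exp_le_one_iff.2 (neg_nonpos.2 (le_of_lt hx))⟩
      simp only [Real.log_exp, neg_neg] at this
      rw [Real.norm_eq_abs, abs_sub_comm]
      exact this.le
    rw [← abs_nonpos_iff]
    refine le_of_forall_pos_le_add fun δ hδ => ?_
    have h1 := hbound (δ / (M + 1)) (by positivity)
    have h2 : δ / (M + 1) * M ≤ δ := by
      rw [div_mul_eq_mul_div, div_le_iff₀ (by positivity)]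
      nlinarith
    linarith
  rw [ae_restrict_iff' measurableSet_Ioi]
  filter_upwards [key] with x hx hx0
  exact (mul_eq_zero.1 (hx hx0)).resolve_left (Real.exp_pos _).ne'

/-- Mellin-type integrals depend continuously on the exponent. -/
theorem continuousOn_integral_rpow_mul {S : Type*} [MeasurableSpace S] {μ : Measure S}
    {t f : S → ℝ} (ht : ∀ᵐ s ∂μ, 0 < t s)
    (hf : ∀ a > (0 : ℝ), Integrable (fun s => t s ^ a * f s) μ) :
    ContinuousOn (fun a : ℝ => ∫ s, t s ^ a * f s ∂μ) (Ioi 0) := by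
  intro a ha
  have ha : 0 < a := ha
  refine ContinuousAt.continuousWithinAt ?_
  refine continuousAt_of_dominated (bound := fun s =>
    ‖t s ^ (a / 2) * f s‖ + ‖t s ^ (2 * a) * f s‖) ?_ ?_
    ((hf _ (by positivity)).norm.add (hf _ (by positivity)).norm) ?_
  · filter_upwards [Ioi_mem_nhds ha] with b hb using (hf b hb).aestronglyMeasurable
  · filter_upwards [Ioo_mem_nhds (show a / 2 < a by linarith) (show a < 2 * a by linarith)]
      with b hb
    filter_upwards [ht] with s hs
    simp only [norm_mul, ← add_mul]
    refine mul_le_mul_of_nonneg_right ?_ (norm_nonneg _)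
    simp only [Real.norm_of_nonneg (Real.rpow_nonneg hs.le _)]
    rcases le_total 1 (t s) with h1 | h1
    · have := Real.rpow_le_rpow_of_exponent_le h1 hb.2.le
      have := Real.rpow_nonneg hs.le (a / 2)
      linarith
    · have := Real.rpow_le_rpow_of_exponent_ge hs h1 hb.1.le
      have := Real.rpow_nonneg hs.le (2 * a)
      linarith
  · filter_upwards [ht] with s hs
    exact (Real.continuousAt_const_rpow hs.ne').mul continuousAt_const

/-- If an estimator based on a Gamma variable with shape `N * a` and an independent variable with
density proportional to `y ^ (a - 1) * K y` is unbiased for a function of `a` alone, then that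
function is continuous and has an unbiased estimator based on the second variable alone. -/
theorem exists_unbiased_estimator_of_gamma_independent {N : ℝ} (hN : 0 < N) {K h : ℝ → ℝ} {U : ℝ → ℝ → ℝ}
    (hKm : Measurable K) (hKpos : ∀ y ∈ Ioo (0 : ℝ) 1, 0 < K y)
    (hK : ∀ a > (0 : ℝ), IntegrableOn (fun y => y ^ (a - 1) * K y) (Ioo 0 1))
    (hU : Measurable (Function.uncurry U))
    (hint : ∀ a > (0 : ℝ), ∀ l > (0 : ℝ),
      IntegrableOn (fun p : ℝ × ℝ => p.1 ^ (N * a - 1) * Real.exp (-l * p.1) *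
        (p.2 ^ (a - 1) * K p.2 * |U p.1 p.2|)) (Ioi 0 ×ˢ Ioo 0 1))
    (hunb : ∀ a > (0 : ℝ), ∀ l > (0 : ℝ),
      l ^ (N * a) * ∫ p in Ioi (0 : ℝ) ×ˢ Ioo (0 : ℝ) 1,
          p.1 ^ (N * a - 1) * Real.exp (-l * p.1) * (p.2 ^ (a - 1) * K p.2 * U p.1 p.2)
        = Real.Gamma (N * a) * h a * ∫ y in Ioo (0 : ℝ) 1, y ^ (a - 1) * K y) :
    ContinuousOn h (Ioi 0) ∧
    ∃ u : ℝ → ℝ, Measurable u ∧ ∀ a > (0 : ℝ),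
      IntegrableOn (fun y => y ^ (a - 1) * K y * |u y|) (Ioo 0 1) ∧
      ∫ y in Ioo (0 : ℝ) 1, y ^ (a - 1) * K y * u y
        = h a * ∫ y in Ioo (0 : ℝ) 1, y ^ (a - 1) * K y := by
  have hIm : MeasurableSet (Ioi (0 : ℝ) ×ˢ Ioo (0 : ℝ) 1) := measurableSet_Ioi.prod measurableSet_Ioo
  have hUint : ∀ a > (0 : ℝ), ∀ l > (0 : ℝ),
      IntegrableOn (fun p : ℝ × ℝ => p.1 ^ (N * a - 1) * Real.exp (-l * p.1) *
        (p.2 ^ (a - 1) * K p.2 * U p.1 p.2)) (Ioi 0 ×ˢ Ioo 0 1) := by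
    intro a ha l hl
    refine Integrable.mono (hint a ha l hl) ?_ (Filter.Eventually.of_forall fun p => ?_)
    · have hU' : Measurable fun p : ℝ × ℝ => U p.1 p.2 := hU
      exact Measurable.aestronglyMeasurable (by fun_prop)
    · simp only [norm_mul, norm_abs_eq_norm, Real.norm_eq_abs, le_refl]
  set B : ℝ → ℝ := fun a => ∫ y in Ioo (0 : ℝ) 1, y ^ (a - 1) * K y with hB
  have hypos : ∀ᵐ y ∂volume.restrict (Ioo (0 : ℝ) 1), 0 < y :=
    ae_restrict_of_forall_mem measurableSet_Ioo fun y hy => hy.1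
  have hweight : ∀ v : ℝ → ℝ, (∀ a > (0 : ℝ), IntegrableOn (fun y => y ^ (a - 1) * v y) (Ioo 0 1)) →
      ContinuousOn (fun a : ℝ => ∫ y in Ioo (0 : ℝ) 1, y ^ (a - 1) * v y) (Ioi 0) := by
    intro v hv
    have he : ∀ a : ℝ, EqOn (fun y => y ^ (a - 1) * v y) (fun y => y ^ a * (v y / y)) (Ioo 0 1) := by
      intro a y hy
      simp only [Real.rpow_sub_one hy.1.ne']
      ring
    refine (continuousOn_integral_rpow_mul (f := fun y => v y / y) hypos fun a ha =>
      (hv a ha).congr_fun (he a) measurableSet_Ioo).congr fun a _ => ?_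
    exact setIntegral_congr_fun measurableSet_Ioo (he a)
  have hBcont : ContinuousOn B (Ioi 0) := hweight K hK
  have hBpos : ∀ a > (0 : ℝ), 0 < B a := by
    intro a ha
    have hpos : ∀ y ∈ Ioo (0 : ℝ) 1, 0 < y ^ (a - 1) * K y := fun y hy =>
      mul_pos (Real.rpow_pos_of_pos hy.1 _) (hKpos y hy)
    rw [hB, setIntegral_pos_iff_support_of_nonneg_ae
      (ae_restrict_of_forall_mem measurableSet_Ioo fun y hy => (hpos y hy).le) (hK a ha)]
    rw [inter_eq_right.2 fun y hy => Function.mem_support.2 (hpos y hy).ne']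
    simp
  have hcont : ContinuousOn h (Ioi 0) := by
    have he : ∀ a : ℝ, EqOn (fun p : ℝ × ℝ => p.1 ^ (N * a - 1) * Real.exp (-1 * p.1) *
        (p.2 ^ (a - 1) * K p.2 * U p.1 p.2)) (fun p => (p.1 ^ N * p.2) ^ a *
        (Real.exp (-1 * p.1) * K p.2 * U p.1 p.2 / (p.1 * p.2))) (Ioi 0 ×ˢ Ioo 0 1) := by
      rintro a ⟨x, y⟩ ⟨hx, hy⟩
      have hx : 0 < x := hx
      have hy : 0 < y := hy.1
      simp only [Real.rpow_sub_one hx.ne', Real.rpow_sub_one hy.ne', Real.rpow_mul hx.le,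
        Real.mul_rpow (Real.rpow_nonneg hx.le N) hy.le]
      field_simp
    have hc := continuousOn_integral_rpow_mul
      (μ := volume.restrict (Ioi (0 : ℝ) ×ˢ Ioo (0 : ℝ) 1))
      (t := fun p : ℝ × ℝ => p.1 ^ N * p.2)
      (f := fun p => Real.exp (-1 * p.1) * K p.2 * U p.1 p.2 / (p.1 * p.2))
      (ae_restrict_of_forall_mem hIm fun p hp => mul_pos (Real.rpow_pos_of_pos hp.1 _) hp.2.1)
      fun a ha => (hUint a ha 1 one_pos).congr_fun (he a) hIm
    have hΓ : ContinuousOn (fun a : ℝ => Real.Gamma (N * a)) (Ioi 0) := by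
      intro a ha
      have hNa : 0 < N * a := mul_pos hN ha
      refine ContinuousAt.continuousWithinAt ?_
      refine ContinuousAt.comp (f := fun a : ℝ => N * a)
        (Real.differentiableAt_Gamma fun m => ?_).continuousAt (by fun_prop)
      have : (0 : ℝ) ≤ m := m.cast_nonneg
      linarith
    refine (hc.div (hΓ.mul hBcont) fun a ha => ?_).congr fun a ha => ?_
    · exact (mul_pos (Real.Gamma_pos_of_pos (mul_pos hN ha)) (hBpos a ha)).ne'
    · have h1 := hunb a ha 1 one_pos
      rw [Real.one_rpow, one_mul, setIntegral_congr_fun hIm (he a)] at h1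
      have h2 := (Real.Gamma_pos_of_pos (mul_pos hN ha)).ne'
      have h3 := (hBpos a ha).ne'
      refine Eq.trans ?_ (congrArg (· / (Real.Gamma (N * a) * B a)) h1.symm)
      change h a = Real.Gamma (N * a) * h a * B a / (Real.Gamma (N * a) * B a)
      field_simp
  refine ⟨hcont, ?_⟩
  have hae : ∀ a > (0 : ℝ), ∀ᵐ x ∂volume.restrict (Ioi (0 : ℝ)),
      IntegrableOn (fun y => y ^ (a - 1) * K y * U x y) (Ioo 0 1) ∧
      ∫ y in Ioo (0 : ℝ) 1, y ^ (a - 1) * K y * U x y = h a * B a := by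
    intro a ha
    have hNa : 0 < N * a := mul_pos hN ha
    set F : ℝ → ℝ := fun x => ∫ y in Ioo (0 : ℝ) 1, y ^ (a - 1) * K y * U x y with hF
    have hprod : ∀ l > (0 : ℝ), Integrable (fun p : ℝ × ℝ => p.1 ^ (N * a - 1) *
        Real.exp (-l * p.1) * (p.2 ^ (a - 1) * K p.2 * U p.1 p.2))
        ((volume.restrict (Ioi (0 : ℝ))).prod (volume.restrict (Ioo (0 : ℝ) 1))) := by
      intro l hl
      rw [Measure.prod_restrict]
      exact hUint a ha l hl
    have hFint : ∀ l > (0 : ℝ),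
        IntegrableOn (fun x => x ^ (N * a - 1) * Real.exp (-l * x) * F x) (Ioi 0) := by
      intro l hl
      have := (hprod l hl).integral_prod_left
      simpa only [integral_const_mul, mul_assoc, hF, IntegrableOn] using this
    have hFval : ∀ l > (0 : ℝ), l ^ (N * a) * ∫ x in Ioi (0 : ℝ),
        x ^ (N * a - 1) * Real.exp (-l * x) * F x = Real.Gamma (N * a) * h a * B a := by
      intro l hl
      rw [← hunb a ha l hl, Measure.volume_eq_prod, ← Measure.prod_restrict,
        integral_prod _ (hprod l hl)]
      simp only [integral_const_mul, hF, mul_assoc]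
    have hconst : ∀ l > (0 : ℝ),
        IntegrableOn (fun x => x ^ (N * a - 1) * Real.exp (-l * x)) (Ioi 0) := by
      intro l hl
      have := integrableOn_rpow_mul_exp_neg_mul_rpow (p := 1) (s := N * a - 1) (b := l)
        (by linarith) one_pos hl
      simpa only [Real.rpow_one] using this
    have hzero : ∀ᵐ x ∂volume.restrict (Ioi (0 : ℝ)),
        x ^ (N * a - 1) * (F x - h a * B a) = 0 := by
      have hsplit : ∀ k : ℕ, (fun x => Real.exp (-((k : ℝ) + 1) * x) *
          (x ^ (N * a - 1) * (F x - h a * B a))) = fun x =>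
          x ^ (N * a - 1) * Real.exp (-((k : ℝ) + 1) * x) * F x -
          x ^ (N * a - 1) * Real.exp (-((k : ℝ) + 1) * x) * (h a * B a) := fun k => by
        funext x; ring
      refine ae_eq_zero_of_laplace_eq_zero (fun k => ?_) fun k => ?_
      · rw [hsplit]
        exact (hFint _ (by positivity)).sub ((hconst _ (by positivity)).mul_const _)
      · have hl : (0 : ℝ) < (k : ℝ) + 1 := by positivity
        rw [hsplit, integral_sub (hFint _ hl) ((hconst _ hl).mul_const _), integral_mul_const]
        have h1 := hFval _ hl
        have h2 := Real.integral_rpow_mul_exp_neg_mul_Ioi hNa hl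
        simp only [← neg_mul] at h2
        rw [h2, one_div, Real.inv_rpow hl.le]
        have h3 : (0 : ℝ) < ((k : ℝ) + 1) ^ (N * a) := Real.rpow_pos_of_pos hl _
        rw [sub_eq_zero]
        rw [← eq_inv_mul_iff_mul_eq₀ h3.ne'] at h1
        rw [h1]
        ring
    filter_upwards [hzero, (hprod 1 one_pos).prod_right_ae,
      ae_restrict_mem measurableSet_Ioi] with x hx hxi hx0
    have hx0 : 0 < x := hx0
    have hxp : x ^ (N * a - 1) ≠ 0 := (Real.rpow_pos_of_pos hx0 _).ne'
    refine ⟨?_, sub_eq_zero.1 ((mul_eq_zero.1 hx).resolve_left hxp)⟩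
    exact (integrable_const_mul_iff (IsUnit.mk0 _ (mul_ne_zero hxp (Real.exp_pos _).ne')) _).1 hxi
  have hall : ∀ᵐ x ∂volume.restrict (Ioi (0 : ℝ)), ∀ q : ℚ, (0 : ℝ) < q →
      IntegrableOn (fun y => y ^ ((q : ℝ) - 1) * K y * U x y) (Ioo 0 1) ∧
      ∫ y in Ioo (0 : ℝ) 1, y ^ ((q : ℝ) - 1) * K y * U x y = h q * B q := by
    rw [ae_all_iff]
    intro q
    by_cases hq : (0 : ℝ) < q
    · filter_upwards [hae q hq] with x hx _ using hx
    · exact Filter.Eventually.of_forall fun x hq' => absurd hq' hq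
  have hne : (ae (volume.restrict (Ioi (0 : ℝ)))).NeBot := by
    rw [ae_neBot, Ne, Measure.restrict_eq_zero]
    simp
  obtain ⟨x, hx⟩ := hall.exists
  have hUx : Measurable (U x) := hU.comp measurable_prodMk_left
  have hxint : ∀ a > (0 : ℝ), IntegrableOn (fun y => y ^ (a - 1) * (K y * U x y)) (Ioo 0 1) := by
    intro a ha
    obtain ⟨q, hq0, hqa⟩ := exists_rat_btwn ha
    refine Integrable.mono (hx q hq0).1 (Measurable.aestronglyMeasurable (by fun_prop))
      (ae_restrict_of_forall_mem measurableSet_Ioo fun y hy => ?_)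
    rw [mul_assoc, norm_mul, norm_mul (y ^ ((q : ℝ) - 1))]
    refine mul_le_mul_of_nonneg_right ?_ (norm_nonneg _)
    simp only [Real.norm_of_nonneg (Real.rpow_nonneg hy.1.le _)]
    exact Real.rpow_le_rpow_of_exponent_ge hy.1 hy.2.le (by linarith)
  have heq : EqOn (fun a : ℝ => ∫ y in Ioo (0 : ℝ) 1, y ^ (a - 1) * (K y * U x y))
      (fun a => h a * B a) (Ioi 0) := by
    refine EqOn.of_subset_closure (s := Ioi 0 ∩ range ((↑) : ℚ → ℝ)) ?_ (hweight _ hxint)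
      (hcont.mul hBcont) inter_subset_left
      (Dense.open_subset_closure_inter Rat.denseRange_cast isOpen_Ioi)
    rintro _ ⟨hq, q, rfl⟩
    simpa only [mul_assoc] using (hx q hq).2
  refine ⟨U x, hUx, fun a ha => ⟨?_, ?_⟩⟩
  · refine (hxint a ha).norm.congr (ae_restrict_of_forall_mem measurableSet_Ioo fun y hy => ?_)
    beta_reduce
    rw [← mul_assoc, norm_mul, Real.norm_of_nonneg
      (mul_nonneg (Real.rpow_nonneg hy.1.le _) (hKpos y hy).le), Real.norm_eq_abs]
  · simpa only [mul_assoc] using heq ha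

/-- If `U(X,Y)` is an unbiased estimator of a function `h(α)` of the shape parameter
alone, then `h` is continuous and some function of `Y` alone is unbiased for `h(α)`. -/
theorem umvue_of_shape_function_depends_only_on_Y
    (n : ℕ) (hn : 2 ≤ n) (h : ℝ → ℝ) (U : ℝ → ℝ → ℝ)
    (hh : Measurable h) (hU : Measurable (Function.uncurry U))
    (hint : ∀ a > (0:ℝ), ∀ l > (0:ℝ),
      IntegrableOn (fun p : ℝ × ℝ =>
          p.1 ^ ((n : ℝ) * a - 1) * Real.exp (-l * p.1) * p.2 ^ (a - 1) *
            (1 - p.2) ^ (((n : ℝ) - 3) / 2) * Gfun n p.2 * |U p.1 p.2|)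
        ((Ioi 0) ×ˢ (Ioo 0 1)))
    (hunb : ∀ a > (0:ℝ), ∀ l > (0:ℝ),
      l ^ ((n : ℝ) * a) *
          ∫ p in (Ioi (0:ℝ)) ×ˢ (Ioo (0:ℝ) 1),
            p.1 ^ ((n : ℝ) * a - 1) * Real.exp (-l * p.1) * p.2 ^ (a - 1) *
              (1 - p.2) ^ (((n : ℝ) - 3) / 2) * Gfun n p.2 * U p.1 p.2
        = Real.Gamma ((n : ℝ) * a) * h a *
            ∫ y in Ioo (0:ℝ) 1, y ^ (a - 1) * (1 - y) ^ (((n : ℝ) - 3) / 2) * Gfun n y) :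
    ContinuousOn h (Ioi 0) ∧
    ∃ u : ℝ → ℝ, Measurable u ∧ ∀ a > (0:ℝ),
      IntegrableOn
        (fun y => y ^ (a - 1) * (1 - y) ^ (((n : ℝ) - 3) / 2) * Gfun n y * |u y|)
        (Ioo 0 1) ∧
      ∫ y in Ioo (0:ℝ) 1, y ^ (a - 1) * (1 - y) ^ (((n : ℝ) - 3) / 2) * Gfun n y * u y
        = h a * ∫ y in Ioo (0:ℝ) 1, y ^ (a - 1) * (1 - y) ^ (((n : ℝ) - 3) / 2) * Gfun n y := by
  have hn0 : (0 : ℝ) < n := by positivity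
  have key := exists_unbiased_estimator_of_gamma_independent (N := n) (h := h) (U := U)
    (K := fun y => (1 - y) ^ (((n : ℝ) - 3) / 2) * Gfun n y) hn0
    (((measurable_const.sub measurable_id).pow_const _).mul (measurable_Gfun n))
    (fun y hy => mul_pos (Real.rpow_pos_of_pos (sub_pos.2 hy.2) _) (Gfun_pos hn hy))
    (fun a ha => integrableOn_rpow_mul_Gfun hn ha) hU
    (by simpa only [mul_assoc] using hint) (by simpa only [mul_assoc] using hunb)
  simpa only [mul_assoc] using key
end

section
/- Let n ≥ 2. Then for every t ∈ [0,1), the series Σ_{m=0}^∞ d_m t^m converges (the family (d_m t^m)_{m≥0} is summable). Consequently the function G(y) = Σ_{m=0}^∞ d_m (1−y)^m is a well-defined finite real number for every y ∈ (0,1). -/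
open MeasureTheory Set

/-- For `0 < a ≤ b`, the ratios `Γ(m + a) / Γ(m + b)` are bounded by their value at `m = 0`. -/
theorem gamma_nat_add_div_le {a b : ℝ} (ha : 0 < a) (hab : a ≤ b) (m : ℕ) :
    Real.Gamma (m + a) / Real.Gamma (m + b) ≤ Real.Gamma a / Real.Gamma b := by
  induction m with
  | zero => simp
  | succ m ih =>
    have hb : 0 < b := ha.trans_le hab
    have hma : (0 : ℝ) < m + a := by positivity
    have hmb : (0 : ℝ) < m + b := by positivity
    have hGa := Real.Gamma_pos_of_pos hma
    have hGb := Real.Gamma_pos_of_pos hmb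
    refine le_trans ?_ ih
    have h (c : ℝ) : ((m + 1 : ℕ) : ℝ) + c = (m + c) + 1 := by push_cast; ring
    rw [h, h, Real.Gamma_add_one hma.ne', Real.Gamma_add_one hmb.ne', mul_div_mul_comm]
    refine mul_le_of_le_one_left (by positivity) ?_
    rw [div_le_one hmb]
    linarith

theorem summable_norm_mul_pow_of_bounded {f : ℕ → ℝ} {C t : ℝ} (hf : ∀ m, |f m| ≤ C)
    (ht : t ∈ Ico (0 : ℝ) 1) : Summable fun m => ‖f m * t ^ m‖ := by
  refine Summable.of_nonneg_of_le (fun m => norm_nonneg _) (fun m => ?_)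
    ((summable_geometric_of_lt_one ht.1 ht.2).mul_left C)
  rw [norm_mul, norm_pow, Real.norm_eq_abs, Real.norm_of_nonneg ht.1]
  exact mul_le_mul_of_nonneg_right (hf m) (pow_nonneg ht.1 m)

/-- The power series with coefficients `γ_i(m)` converges absolutely on `[0, 1)`. -/
theorem gammaCoeff_summable_norm {n : ℕ} {t : ℝ} (ht : t ∈ Ico (0 : ℝ) 1) :
    ∀ i ≤ n, Summable fun m => ‖gammaCoeff n i m * t ^ m‖
  | 0, _ => by simp [gammaCoeff]
  | 1, _ => by
    refine summable_norm_mul_pow_of_bounded (C := 1) (fun m => ?_) ht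
    rw [gammaCoeff]
    split_ifs <;> simp
  | i + 2, hi => by
    have ih := gammaCoeff_summable_norm (n := n) ht (i + 1) (by omega)
    have hn : (0 : ℝ) < n := by exact_mod_cast (by omega : 0 < n)
    set α : ℝ := ((i : ℝ) + 2) / n with hα
    set a : ℝ := ((i : ℝ) + 1) * ((i : ℝ) + 2) / (2 * n) with ha
    set b : ℝ := ((i : ℝ) + 2) * ((i : ℝ) + 3) / (2 * n) with hb
    have hα0 : 0 < α := by positivity
    have ha0 : 0 < a := by positivity
    have hb0 : 0 < b := by positivity
    have hα1 : α ≤ 1 := by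
      rw [hα, div_le_one hn]
      exact_mod_cast hi
    have hab : a ≤ b := by
      rw [ha, hb]
      gcongr ?_ / _
      nlinarith [(Nat.cast_nonneg i : (0 : ℝ) ≤ i)]
    have hG {c : ℝ} (hc : 0 < c) (m : ℕ) : 0 < Real.Gamma (m + c) :=
      Real.Gamma_pos_of_pos (by positivity)
    have hw : Summable fun j : ℕ => ‖Real.Gamma (j + α) / (j.factorial : ℝ) * t ^ j‖ := by
      refine summable_norm_mul_pow_of_bounded (C := Real.Gamma α / Real.Gamma 1) (fun j => ?_) ht
      rw [abs_of_nonneg (div_nonneg (hG hα0 j).le (by positivity)), ← Real.Gamma_nat_eq_factorial]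
      exact gamma_nat_add_div_le hα0 hα1 j
    have hconv := summable_norm_sum_mul_range_of_summable_norm ih hw
    refine Summable.of_nonneg_of_le (fun m => norm_nonneg _) (fun m => ?_)
      (hconv.mul_left (Real.Gamma a / Real.Gamma b))
    have hsum : gammaCoeff n (i + 2) m * t ^ m = Real.Gamma (m + a) / Real.Gamma (m + b) *
        ∑ k ∈ Finset.range (m + 1), gammaCoeff n (i + 1) k * t ^ k *
          (Real.Gamma ((m - k : ℕ) + α) / ((m - k).factorial : ℝ) * t ^ (m - k)) := by
      rw [gammaCoeff, mul_assoc, Finset.sum_mul]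
      congr 1
      refine Finset.sum_congr rfl fun k hk => ?_
      rw [← pow_mul_pow_sub t (Finset.mem_range_succ_iff.mp hk)]
      ring
    rw [hsum, norm_mul, Real.norm_of_nonneg (div_pos (hG ha0 m) (hG hb0 m)).le]
    exact mul_le_mul_of_nonneg_right (gamma_nat_add_div_le ha0 hab m) (norm_nonneg _)

/-- For `n ≥ 2`, the series `Σ d_m t^m` converges for every `t ∈ [0,1)`; consequently
`G(y) = Σ d_m (1−y)^m` is a well-defined finite real number for every `y ∈ (0,1)`. -/
theorem dCoeff_series_summable (n : ℕ) (hn : 2 ≤ n) :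
    (∀ t ∈ Ico (0:ℝ) 1, Summable (fun m : ℕ => dCoeff n m * t ^ m)) ∧
    (∀ y ∈ Ioo (0:ℝ) 1, Summable (fun m : ℕ => dCoeff n m * (1 - y) ^ m)) := by
  have h : ∀ t ∈ Ico (0 : ℝ) 1, Summable fun m : ℕ => dCoeff n m * t ^ m := fun t ht =>
    (gammaCoeff_summable_norm ht (n - 1) (Nat.sub_le n 1)).of_norm
  exact ⟨h, fun y hy => h (1 - y) ⟨by linarith [hy.2], by linarith [hy.1]⟩⟩
end

section
/- Let n ≥ 2, let 1 ≤ i ≤ n−1, and let α > 0. Then the series Σ_{m=0}^∞ (Γ(m + i(i+1)/(2n)) / Γ(α + m + i(i+1)/(2n))) · γ_i(m) converges, and its sum equals Γ(α)^{i−1} · Π_{j=1}^{i} ( Γ(j/n) / Γ(α + j/n) ). In particular, for i = n−1 (so that i(i+1)/(2n) = (n−1)/2): Σ_{m=0}^∞ (Γ(m + (n−1)/2) / Γ(α + m + (n−1)/2)) · d_m = Γ(α)^{n−2} · Π_{j=1}^{n−1} ( Γ(j/n) / Γ(α + j/n) ). -/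
open MeasureTheory Set

open ProbabilityTheory in
theorem lintegral_rpow_mul_one_sub_rpow {p q : ℝ} (hp : 0 < p) (hq : 0 < q) :
    ∫⁻ x in Ioo (0 : ℝ) 1, ENNReal.ofReal (x ^ (p - 1) * (1 - x) ^ (q - 1)) =
      ENNReal.ofReal (beta p q) := by
  have hbeta := beta_pos hp hq
  have h := lintegral_betaPDF_eq_one hp hq
  simp_rw [lintegral_betaPDF, mul_assoc,
    ENNReal.ofReal_mul (one_div_pos.2 hbeta).le] at h
  rw [lintegral_const_mul' _ _ ENNReal.ofReal_ne_top] at h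
  rw [← mul_one (ENNReal.ofReal (beta p q)), ← h, ← mul_assoc, ← ENNReal.ofReal_mul hbeta.le,
    mul_one_div_cancel hbeta.ne', ENNReal.ofReal_one, one_mul]

theorem Real.Gamma_add_natCast {b : ℝ} (hb : 0 < b) (l : ℕ) :
    Real.Gamma (b + l) = (ascPochhammer ℝ l).eval b * Real.Gamma b := by
  induction l with
  | zero => simp
  | succ l ih =>
    rw [Nat.cast_succ, ← add_assoc, Real.Gamma_add_one (by positivity), ih,
      ascPochhammer_succ_eval]
    ring

theorem Real.hasSum_Gamma_add_div_factorial_mul_pow {b x : ℝ} (hb : 0 < b) (hx0 : 0 ≤ x)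
    (hx1 : x < 1) :
    HasSum (fun l : ℕ => Real.Gamma (b + l) / (l.factorial : ℝ) * x ^ l)
      (Real.Gamma b * (1 - x) ^ (-b)) := by
  have h := (Real.one_div_one_sub_rpow_hasFPowerSeriesOnBall_zero b).hasSum
    (y := x) (by simpa [enorm_eq_nnnorm, abs_of_nonneg hx0, ← NNReal.coe_lt_coe] using hx1)
  convert! h.mul_left (Real.Gamma b) using 1
  · ext l
    have hfac : (l.factorial : ℝ) * Ring.choose (b + l - 1) l = (ascPochhammer ℝ l).eval b := by
      rw [← Ring.multichoose_eq, ← nsmul_eq_mul, Ring.factorial_nsmul_multichoose_eq_ascPochhammer,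
        Polynomial.ascPochhammer_smeval_eq_eval]
    have hl : (l.factorial : ℝ) ≠ 0 := by positivity
    rw [Real.Gamma_add_natCast hb, ← hfac]
    simp [FormalMultilinearSeries.ofScalars]
    field_simp
  · rw [zero_add, Real.rpow_neg (by linarith), one_div]

theorem hasSum_of_tsum_ofReal_eq {ι : Type*} {f : ι → ℝ} {s : ℝ} (hf : ∀ i, 0 ≤ f i) (hs : 0 ≤ s)
    (h : ∑' i, ENNReal.ofReal (f i) = ENNReal.ofReal s) : HasSum f s := by
  have h' := ENNReal.hasSum_toReal (h ▸ ENNReal.ofReal_ne_top)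
  rw [← ENNReal.tsum_toReal_eq fun _ => ENNReal.ofReal_ne_top, h] at h'
  simpa only [ENNReal.toReal_ofReal (hf _), ENNReal.toReal_ofReal hs] using h'

open ProbabilityTheory in
theorem hasSum_Gamma_mul_beta {p q r : ℝ} (hp : 0 < p) (hq : 0 < q) (hr : 0 < r) :
    HasSum (fun l : ℕ => Real.Gamma (q + l) / (l.factorial : ℝ) * beta (p + l) (q + r))
      (Real.Gamma q * beta p r) := by
  have hcoeff (l : ℕ) : 0 ≤ Real.Gamma (q + l) / (l.factorial : ℝ) :=
    div_nonneg (Real.Gamma_pos_of_pos (by positivity)).le (by positivity)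
  have hGq := (Real.Gamma_pos_of_pos hq).le
  refine hasSum_of_tsum_ofReal_eq
    (fun l => mul_nonneg (hcoeff l) (beta_pos (by positivity) (by positivity)).le)
    (mul_nonneg hGq (beta_pos hp hr).le) ?_
  have hterm (l : ℕ) :
      ENNReal.ofReal (Real.Gamma (q + l) / (l.factorial : ℝ) * beta (p + l) (q + r)) =
        ∫⁻ x in Ioo (0 : ℝ) 1, ENNReal.ofReal (Real.Gamma (q + l) / (l.factorial : ℝ) *
          (x ^ (p + l - 1) * (1 - x) ^ (q + r - 1))) := by
    simp_rw [ENNReal.ofReal_mul (hcoeff l)]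
    rw [lintegral_const_mul' _ _ ENNReal.ofReal_ne_top,
      lintegral_rpow_mul_one_sub_rpow (by positivity) (by positivity)]
  simp_rw [hterm]
  rw [← lintegral_tsum (fun l => by fun_prop), ENNReal.ofReal_mul hGq,
    ← lintegral_rpow_mul_one_sub_rpow hp hr, ← lintegral_const_mul' _ _ ENNReal.ofReal_ne_top]
  refine setLIntegral_congr_fun measurableSet_Ioo fun x hx => ?_
  have hx1 : 0 < 1 - x := sub_pos.2 hx.2
  have hx0 := hx.1
  have hsum := (Real.hasSum_Gamma_add_div_factorial_mul_pow hq hx0.le hx.2).mul_left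
    (x ^ (p - 1) * (1 - x) ^ (q + r - 1))
  have hval : x ^ (p - 1) * (1 - x) ^ (q + r - 1) * (Real.Gamma q * (1 - x) ^ (-q)) =
      Real.Gamma q * (x ^ (p - 1) * (1 - x) ^ (r - 1)) := by
    rw [show r - 1 = (q + r - 1) + -q by ring, Real.rpow_add hx1]
    ring
  have hfun (l : ℕ) : x ^ (p - 1) * (1 - x) ^ (q + r - 1) *
      (Real.Gamma (q + l) / (l.factorial : ℝ) * x ^ l) =
        Real.Gamma (q + l) / (l.factorial : ℝ) * (x ^ (p + l - 1) * (1 - x) ^ (q + r - 1)) := by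
    rw [show p + l - 1 = (p - 1) + l by ring, Real.rpow_add hx0, Real.rpow_natCast]
    ring
  simp_rw [hval, hfun] at hsum
  rw [← ENNReal.ofReal_mul hGq, ← hsum.tsum_eq, ENNReal.ofReal_tsum_of_nonneg _ hsum.summable]
  exact fun l => mul_nonneg (hcoeff l) (by positivity)

/-- **Gauss's summation formula** for `₂F₁(p, q; p + q + r; 1)` with positive parameters, in
Gamma-function form. -/
theorem hasSum_Gamma_mul_Gamma_div_Gamma {p q r : ℝ} (hp : 0 < p) (hq : 0 < q) (hr : 0 < r) :
    HasSum (fun l : ℕ => Real.Gamma (p + l) / Real.Gamma (r + (p + l) + q) *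
        (Real.Gamma (q + l) / (l.factorial : ℝ)))
      (Real.Gamma r * (Real.Gamma q / Real.Gamma (r + q)) *
        (Real.Gamma p / Real.Gamma (r + p))) := by
  have hqr : Real.Gamma (q + r) ≠ 0 := (Real.Gamma_pos_of_pos (by positivity)).ne'
  convert! (hasSum_Gamma_mul_beta hp hq hr).div_const (Real.Gamma (q + r)) using 1
  · ext l
    rw [ProbabilityTheory.beta, show r + (p + l) + q = p + l + (q + r) by ring]
    field_simp
  · rw [ProbabilityTheory.beta, add_comm r q, add_comm r p]
    field_simp

theorem HasSum.sum_antidiagonal_of_nonneg {f : ℕ → ℕ → ℝ} {g : ℕ → ℝ} {s : ℝ}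
    (hf : ∀ k l, 0 ≤ f k l) (hg : ∀ k, HasSum (f k) (g k)) (hs : HasSum g s) :
    HasSum (fun m => ∑ p ∈ Finset.HasAntidiagonal.antidiagonal m, f p.1 p.2) s := by
  have hsum : Summable fun p : ℕ × ℕ => f p.1 p.2 := by
    refine (summable_prod_of_nonneg fun p => hf p.1 p.2).2 ⟨fun k => (hg k).summable, ?_⟩
    simpa only [(hg _).tsum_eq] using hs.summable
  have h := hsum.hasSum
  rw [(h.prod_fiberwise hg).unique hs,
    ← Finset.HasAntidiagonal.sigmaAntidiagonalEquivProd.hasSum_iff] at h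
  refine h.sigma fun m => ?_
  rw [← Finset.sum_finset_coe]
  exact hasSum_fintype _

theorem hasSum_gammaCoeff {n : ℕ} (hn : 0 < n) (i : ℕ) {a : ℝ} (ha : 0 < a) :
    HasSum (fun m : ℕ =>
      Real.Gamma (m + ((i : ℝ) + 1) * ((i : ℝ) + 2) / (2 * n)) /
        Real.Gamma (a + m + ((i : ℝ) + 1) * ((i : ℝ) + 2) / (2 * n)) * gammaCoeff n (i + 1) m)
      (Real.Gamma a ^ i * ∏ j ∈ Finset.Icc 1 (i + 1),
        Real.Gamma ((j : ℝ) / n) / Real.Gamma (a + (j : ℝ) / n)) := by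
  have hn' : (0 : ℝ) < n := by exact_mod_cast hn
  induction i with
  | zero =>
    convert! hasSum_ite_eq (0 : ℕ)
      (Real.Gamma ((1 : ℝ) / n) / Real.Gamma (a + 1 / n)) using 1
    · ext m
      rcases eq_or_ne m 0 with rfl | hm
      · have h2 : (2 : ℝ) / (2 * n) = 1 / n := by field_simp
        simp [gammaCoeff, h2]
      · simp [gammaCoeff, hm]
    · simp
  | succ i ih =>
    set c : ℝ := ((i : ℝ) + 1) * ((i : ℝ) + 2) / (2 * n) with hc
    set b : ℝ := ((i : ℝ) + 2) / n with hb
    have hc0 : 0 < c := by positivity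
    have hb0 : 0 < b := by positivity
    have hcb : ((i : ℝ) + 2) * ((i : ℝ) + 3) / (2 * n) = c + b := by
      rw [hc, hb]; field_simp; ring
    have hgauss (k : ℕ) := (hasSum_Gamma_mul_Gamma_div_Gamma (p := k + c) (by positivity) hb0
      ha).mul_right (gammaCoeff n (i + 1) k)
    have hΓ {x : ℝ} (hx : 0 ≤ x) : 0 ≤ Real.Gamma x := Real.Gamma_nonneg_of_nonneg hx
    have key := HasSum.sum_antidiagonal_of_nonneg
      (fun k l => mul_nonneg (mul_nonneg (div_nonneg (hΓ (by positivity)) (hΓ (by positivity)))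
        (div_nonneg (hΓ (by positivity)) (by positivity))) (gammaCoeff_nonneg n (i + 1) k))
      hgauss (s := Real.Gamma a ^ (i + 1) * ∏ j ∈ Finset.Icc 1 (i + 1 + 1),
        Real.Gamma ((j : ℝ) / n) / Real.Gamma (a + (j : ℝ) / n)) (by
        convert! ih.mul_left (Real.Gamma a * (Real.Gamma b / Real.Gamma (a + b))) using 1
        · ext k
          rw [add_assoc a]
          ring
        · rw [Finset.prod_Icc_succ_top (by omega),
            show ((i + 1 + 1 : ℕ) : ℝ) / n = b by rw [hb]; push_cast; ring]
          ring)
    convert! key using 1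
    ext m
    rw [Finset.Nat.sum_antidiagonal_eq_sum_range_succ (fun k l : ℕ =>
      Real.Gamma (k + c + l) / Real.Gamma (a + (k + c + l) + b) *
        (Real.Gamma (b + l) / (l.factorial : ℝ)) * gammaCoeff n (i + 1) k), gammaCoeff]
    push_cast
    rw [show ((i : ℝ) + 1 + 1) * ((i : ℝ) + 1 + 2) / (2 * n) = c + b by rw [← hcb]; ring,
      hcb, ← hc, ← hb, ← mul_assoc, Finset.mul_sum]
    refine Finset.sum_congr rfl fun k hk => ?_
    have hkm : (k : ℝ) + c + ((m - k : ℕ) : ℝ) = m + c := by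
      rw [Nat.cast_sub (Finset.mem_range_succ_iff.1 hk)]; ring
    rw [hkm, add_comm b, show a + (m + c) + b = a + m + (c + b) by ring]
    have hne : Real.Gamma (m + (c + b)) ≠ 0 := (Real.Gamma_pos_of_pos (by positivity)).ne'
    field_simp

/-- The key series identity (equation (2.11) of the paper):
`Σ_m Γ(m + i(i+1)/(2n))/Γ(α + m + i(i+1)/(2n)) γ_i(m)
   = Γ(α)^{i−1} Π_{j=1}^i Γ(j/n)/Γ(α + j/n)`. -/
theorem gammaCoeff_series_identity (n : ℕ) (hn : 2 ≤ n) (i : ℕ)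
    (hi1 : 1 ≤ i) (hi2 : i ≤ n - 1) (a : ℝ) (ha : 0 < a) :
    Summable (fun m : ℕ =>
      Real.Gamma ((m : ℝ) + (i : ℝ) * ((i : ℝ) + 1) / (2 * (n : ℝ))) /
        Real.Gamma (a + (m : ℝ) + (i : ℝ) * ((i : ℝ) + 1) / (2 * (n : ℝ))) *
          gammaCoeff n i m) ∧
    ∑' m : ℕ, Real.Gamma ((m : ℝ) + (i : ℝ) * ((i : ℝ) + 1) / (2 * (n : ℝ))) /
        Real.Gamma (a + (m : ℝ) + (i : ℝ) * ((i : ℝ) + 1) / (2 * (n : ℝ))) *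
          gammaCoeff n i m
      = Real.Gamma a ^ (i - 1) *
          ∏ j ∈ Finset.Icc 1 i, Real.Gamma ((j : ℝ) / (n : ℝ)) /
            Real.Gamma (a + (j : ℝ) / (n : ℝ)) := by
  obtain ⟨i, rfl⟩ := Nat.exists_eq_add_of_le' hi1
  have h := hasSum_gammaCoeff (by omega : 0 < n) i ha
  rw [show ((i + 1 : ℕ) : ℝ) * (((i + 1 : ℕ) : ℝ) + 1) = ((i : ℝ) + 1) * ((i : ℝ) + 2) by
    push_cast; ring]
  exact ⟨h.summable, h.tsum_eq⟩
end

section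
/- Let 0 < θ ≤ 1 and let 0 ≤ a < b be real numbers. There is no Borel measurable function δ : (0,∞) → ℝ satisfying both: (i) ∫₀^∞ e^{−λx} x^{θ−1} |δ(x)| dx < ∞ for every λ ∈ (a,b), and (ii) Γ(θ) · λ^{1−θ} = ∫₀^∞ e^{−λx} x^{θ−1} δ(x) dx for every λ ∈ (a,b). -/
open MeasureTheory Set

open Filter Topology

open scoped NNReal

/-- If the Laplace integral of `f` over `(0, ∞)` converges absolutely at `s`, it converges
absolutely at every `t ≥ s`. -/
lemma integrableOn_exp_neg_mul_mul_of_le {f : ℝ → ℝ} (hf : Measurable f) {s t : ℝ} (hst : s ≤ t)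
    (h : IntegrableOn (fun x => Real.exp (-s * x) * f x) (Ioi 0)) :
    IntegrableOn (fun x => Real.exp (-t * x) * f x) (Ioi 0) := by
  refine Integrable.mono h (by fun_prop) ?_
  filter_upwards [ae_restrict_mem measurableSet_Ioi] with x hx
  have hx : 0 < x := hx
  rw [norm_mul, norm_mul, Real.norm_of_nonneg (Real.exp_nonneg _),
    Real.norm_of_nonneg (Real.exp_nonneg _)]
  gcongr

/-- The Laplace transform of a nonnegative function is analytic where it converges. -/
lemma analyticOnNhd_laplace_nnreal {g : ℝ → ℝ≥0} (hg : Measurable g) {a : ℝ}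
    (h : ∀ l ∈ Ioi a, IntegrableOn (fun x => Real.exp (-l * x) * g x) (Ioi 0)) :
    AnalyticOnNhd ℝ (fun l => ∫ x in Ioi (0 : ℝ), Real.exp (-l * x) * g x) (Ioi a) := by
  set μ : Measure ℝ := (volume.restrict (Ioi 0)).withDensity (fun x => (g x : ENNReal)) with hμ
  have hmgf : ProbabilityTheory.mgf (fun x => -x) μ
      = fun l => ∫ x in Ioi (0 : ℝ), Real.exp (-l * x) * g x := by
    ext l
    rw [ProbabilityTheory.mgf, hμ, integral_withDensity_eq_integral_smul hg]
    refine integral_congr_ae (ae_of_all _ fun x => ?_)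
    simp [NNReal.smul_def, mul_comm]
  have hsub : Ioi a ⊆ interior (ProbabilityTheory.integrableExpSet (fun x => -x) μ) := by
    refine interior_maximal (fun l hl => ?_) isOpen_Ioi
    change Integrable _ _
    rw [hμ, integrable_withDensity_iff_integrable_smul hg]
    refine (h l hl).congr (ae_of_all _ fun x => ?_)
    simp [NNReal.smul_def, mul_comm]
  rw [← hmgf]
  exact ProbabilityTheory.analyticOnNhd_mgf.mono hsub

/-- The Laplace transform of a real function is analytic on every half-line of absolute
convergence. -/
lemma analyticOnNhd_laplace {f : ℝ → ℝ} (hf : Measurable f) {a : ℝ}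
    (h : ∀ l ∈ Ioi a, IntegrableOn (fun x => Real.exp (-l * x) * f x) (Ioi 0)) :
    AnalyticOnNhd ℝ (fun l => ∫ x in Ioi (0 : ℝ), Real.exp (-l * x) * f x) (Ioi a) := by
  have key : ∀ u : ℝ → ℝ, Measurable u → (∀ x, |u x| = |f x|) → ∀ l ∈ Ioi a,
      IntegrableOn (fun x => Real.exp (-l * x) * (u x).toNNReal) (Ioi 0) := by
    intro u hu huf l hl
    refine Integrable.mono (h l hl) (by fun_prop) (ae_of_all _ fun x => ?_)
    rw [norm_mul, norm_mul]
    gcongr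
    rw [Real.norm_eq_abs, Real.norm_eq_abs, ← huf, NNReal.abs_eq, Real.coe_toNNReal']
    exact max_le (le_abs_self _) (abs_nonneg _)
  have hpos := key f hf fun _ => rfl
  have hneg := key (fun x => -f x) hf.neg fun x => abs_neg (f x)
  refine ((analyticOnNhd_laplace_nnreal hf.real_toNNReal hpos).sub
    (analyticOnNhd_laplace_nnreal hf.neg.real_toNNReal hneg)).congr isOpen_Ioi fun l hl => ?_
  simp only [Pi.sub_apply]
  refine (integral_sub (hpos l hl) (hneg l hl)).symm.trans
    (integral_congr_ae (ae_of_all _ fun x => ?_))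
  simp only [Real.coe_toNNReal']
  rw [← mul_sub, ← max_zero_sub_eq_self (f x)]
  simp

/-- A Laplace transform tends to zero at infinity. -/
lemma tendsto_laplace_atTop {f : ℝ → ℝ} (hf : Measurable f) {c : ℝ}
    (h : IntegrableOn (fun x => Real.exp (-c * x) * f x) (Ioi 0)) :
    Tendsto (fun l => ∫ x in Ioi (0 : ℝ), Real.exp (-l * x) * f x) atTop (𝓝 0) := by
  suffices H : Tendsto (fun l => ∫ x in Ioi (0 : ℝ), Real.exp (-l * x) * f x) atTop
      (𝓝 (∫ _ in Ioi (0 : ℝ), (0 : ℝ))) by simpa only [integral_zero] using H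
  refine tendsto_integral_filter_of_dominated_convergence
    (fun x => ‖Real.exp (-c * x) * f x‖)
    (.of_forall fun l => Measurable.aestronglyMeasurable (by fun_prop)) ?_ h.norm ?_
  · filter_upwards [eventually_ge_atTop c] with l hl
    filter_upwards [ae_restrict_mem measurableSet_Ioi] with x hx
    have hx : 0 < x := hx
    rw [norm_mul, norm_mul, Real.norm_of_nonneg (Real.exp_nonneg _),
      Real.norm_of_nonneg (Real.exp_nonneg _)]
    gcongr
  · filter_upwards [ae_restrict_mem measurableSet_Ioi] with x hx
    have hx : 0 < x := hx
    have : Tendsto (fun l : ℝ => Real.exp (-l * x)) atTop (𝓝 0) := by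
      simp only [neg_mul]
      exact Real.tendsto_exp_neg_atTop_nhds_zero.comp (tendsto_id.atTop_mul_const hx)
    simpa using this.mul_const (f x)

/-- A real power function is analytic at every positive point. -/
lemma analyticAt_rpow_const_of_pos (p : ℝ) {x : ℝ} (hx : 0 < x) :
    AnalyticAt ℝ (fun y : ℝ => y ^ p) x := by
  refine ((analyticAt_id.log hx).mul (analyticAt_const (v := p))).rexp'.congr ?_
  filter_upwards [lt_mem_nhds hx] with y hy
  exact (Real.rpow_def_of_pos hy p).symm

/-- Nonexistence of an unbiased estimator of the rate parameter when `θ = nα ≤ 1`: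
no Borel measurable `δ : (0,∞) → ℝ` satisfies both
`∫₀^∞ e^{−λx} x^{θ−1} |δ(x)| dx < ∞` and
`Γ(θ) λ^{1−θ} = ∫₀^∞ e^{−λx} x^{θ−1} δ(x) dx` for all `λ ∈ (a,b)`. -/
theorem no_unbiased_estimator_rate (θ a b : ℝ) (hθ0 : 0 < θ) (hθ1 : θ ≤ 1)
    (ha : 0 ≤ a) (hab : a < b) :
    ¬ ∃ δ : ℝ → ℝ, Measurable δ ∧
      (∀ l ∈ Ioo a b,
        IntegrableOn (fun x => Real.exp (-l * x) * x ^ (θ - 1) * |δ x|) (Ioi 0)) ∧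
      (∀ l ∈ Ioo a b,
        Real.Gamma θ * l ^ (1 - θ) =
          ∫ x in Ioi (0:ℝ), Real.exp (-l * x) * x ^ (θ - 1) * δ x) := by
  rintro ⟨δ, hδ, hint, heq⟩
  set f : ℝ → ℝ := fun x => x ^ (θ - 1) * δ x with hf_def
  have hf : Measurable f := by fun_prop
  have hint_Ioo : ∀ l ∈ Ioo a b, IntegrableOn (fun x => Real.exp (-l * x) * f x) (Ioi 0) := by
    intro l hl
    refine Integrable.mono (hint l hl) (by fun_prop) (ae_of_all _ fun x => ?_)
    simp [hf_def, mul_assoc]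
  have hint_Ioi : ∀ l ∈ Ioi a, IntegrableOn (fun x => Real.exp (-l * x) * f x) (Ioi 0) := by
    intro l hl
    obtain ⟨s, has, hs⟩ := exists_between (lt_min hl hab)
    exact integrableOn_exp_neg_mul_mul_of_le hf (hs.le.trans (min_le_left _ _))
      (hint_Ioo s ⟨has, hs.trans_le (min_le_right _ _)⟩)
  have hpow : AnalyticOnNhd ℝ (fun l : ℝ => Real.Gamma θ * l ^ (1 - θ)) (Ioi a) := fun l hl =>
    analyticAt_const.mul (analyticAt_rpow_const_of_pos (1 - θ) (ha.trans_lt hl))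
  obtain ⟨m, hm⟩ := exists_between hab
  have hEq := hpow.eqOn_of_preconnected_of_eventuallyEq (analyticOnNhd_laplace hf hint_Ioi)
    isPreconnected_Ioi (mem_Ioi.2 hm.1) (by
      filter_upwards [Ioo_mem_nhds hm.1 hm.2] with l hl
      simpa only [hf_def, ← mul_assoc] using heq l hl)
  refine absurd (ge_of_tendsto (tendsto_laplace_atTop hf (hint_Ioo m hm)) ?_)
    (not_le.2 (Real.Gamma_pos_of_pos hθ0))
  filter_upwards [eventually_gt_atTop a, eventually_ge_atTop 1] with l hla hl1
  exact (le_mul_of_one_le_right (Real.Gamma_pos_of_pos hθ0).le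
    (Real.one_le_rpow hl1 (sub_nonneg.2 hθ1))).trans_eq (hEq hla)
end

section
/- Let x₁ > 0 and x₂ > 0 with x₁ ≠ x₂, and set y = 4x₁x₂/(x₁+x₂)². Then 0 < y < 1 and √(1−y) · ( 2·log(1 + √(1−y)) − log y ) = (x₂ − x₁)(log x₂ − log x₁) / (x₁ + x₂). -/
theorem one_sub_four_mul_div_add_sq {a b : ℝ} (h : a + b ≠ 0) :
    1 - 4 * a * b / (a + b) ^ 2 = ((b - a) / (a + b)) ^ 2 := by
  field_simp
  ring

theorem sqrt_mul_log_sub_log_of_le {a b : ℝ} (ha : 0 < a) (hab : a ≤ b) :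
    Real.sqrt (1 - 4 * a * b / (a + b) ^ 2) *
        (2 * Real.log (1 + Real.sqrt (1 - 4 * a * b / (a + b) ^ 2)) -
          Real.log (4 * a * b / (a + b) ^ 2))
      = (b - a) * (Real.log b - Real.log a) / (a + b) := by
  have hb : 0 < b := ha.trans_le hab
  have hs : 0 < a + b := add_pos ha hb
  have hone : 1 + (b - a) / (a + b) = 2 * b / (a + b) := by
    field_simp
    ring
  have hlog : Real.log 4 = 2 * Real.log 2 := by
    rw [show (4 : ℝ) = 2 ^ 2 by norm_num, Real.log_pow, Nat.cast_ofNat]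
  rw [one_sub_four_mul_div_add_sq hs.ne', Real.sqrt_sq (div_nonneg (sub_nonneg.2 hab) hs.le),
    hone, Real.log_div (by positivity) hs.ne', Real.log_mul two_ne_zero hb.ne',
    Real.log_div (by positivity) (by positivity), Real.log_mul (by positivity) hb.ne',
    Real.log_mul four_ne_zero ha.ne', Real.log_pow, hlog]
  push_cast
  ring

/-- Closed-form identity of the paper's Remark 2.7: with `y = 4x₁x₂/(x₁+x₂)²` one has
`0 < y < 1` and `√(1−y)(2 log(1+√(1−y)) − log y) = (x₂−x₁)(log x₂ − log x₁)/(x₁+x₂)`. -/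
theorem closed_form_umvue_n_two (x₁ x₂ : ℝ) (h₁ : 0 < x₁) (h₂ : 0 < x₂) (hne : x₁ ≠ x₂) :
    (0 < 4 * x₁ * x₂ / (x₁ + x₂) ^ 2 ∧ 4 * x₁ * x₂ / (x₁ + x₂) ^ 2 < 1) ∧
    Real.sqrt (1 - 4 * x₁ * x₂ / (x₁ + x₂) ^ 2) *
        (2 * Real.log (1 + Real.sqrt (1 - 4 * x₁ * x₂ / (x₁ + x₂) ^ 2)) -
          Real.log (4 * x₁ * x₂ / (x₁ + x₂) ^ 2))
      = (x₂ - x₁) * (Real.log x₂ - Real.log x₁) / (x₁ + x₂) := by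
  have hs : 0 < x₁ + x₂ := add_pos h₁ h₂
  refine ⟨⟨by positivity, ?_⟩, ?_⟩
  · rw [← sub_pos, one_sub_four_mul_div_add_sq hs.ne']
    exact sq_pos_of_ne_zero (div_ne_zero (sub_ne_zero.2 hne.symm) hs.ne')
  · rcases le_total x₁ x₂ with h | h
    · exact sqrt_mul_log_sub_log_of_le h₁ h
    · have key := sqrt_mul_log_sub_log_of_le h₂ h
      rw [add_comm x₂ x₁, mul_right_comm 4 x₂ x₁] at key
      rw [key]
      ring
end

section
/- Let n ≥ 2 be an integer and α > 0. Then Σ_{i=1}^{n−1} ψ₁(α + i/n) < n/α, where ψ₁ denotes the trigamma function, i.e. ψ₁(x) is the second derivative of the function t ↦ log Γ(t) at x, Γ being the real Gamma function. -/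
open Real Set in
theorem differentiableAt_log_Gamma {x : ℝ} (hx : 0 < x) :
    DifferentiableAt ℝ (fun t => Real.log (Real.Gamma t)) x :=
  ((differentiableOn_Gamma_Ioi x hx).differentiableAt (Ioi_mem_nhds hx)).log
    (Gamma_pos_of_pos hx).ne'

theorem log_Gamma_add_one {x : ℝ} (hx : 0 < x) :
    Real.log (Real.Gamma (x + 1)) = Real.log (Real.Gamma x) + Real.log x := by
  rw [Real.Gamma_add_one hx.ne', Real.log_mul hx.ne' (Real.Gamma_pos_of_pos hx).ne', add_comm]

/-- The logarithmic derivative of the real Gamma function. -/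
noncomputable def realDigamma : ℝ → ℝ := deriv fun t => Real.log (Real.Gamma t)

theorem realDigamma_add_one {x : ℝ} (hx : 0 < x) :
    realDigamma (x + 1) = realDigamma x + x⁻¹ := by
  have h : (fun t => Real.log (Real.Gamma (t + 1))) =ᶠ[nhds x]
      fun t => Real.log (Real.Gamma t) + Real.log t := by
    filter_upwards [Ioi_mem_nhds hx] with t ht using log_Gamma_add_one ht
  have h' := h.deriv_eq
  rw [deriv_comp_add_const (f := fun t => Real.log (Real.Gamma t)),
    deriv_fun_add (differentiableAt_log_Gamma hx) (Real.differentiableAt_log hx.ne'),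
    Real.deriv_log] at h'
  exact h'

theorem realDigamma_add_natCast {x : ℝ} (hx : 0 < x) (N : ℕ) :
    realDigamma (x + N) = realDigamma x + ∑ m ∈ Finset.range N, (x + m)⁻¹ := by
  induction N with
  | zero => simp
  | succ N ih =>
    rw [Finset.sum_range_succ, ← add_assoc, ← ih, ← realDigamma_add_one (by positivity)]
    push_cast
    ring_nf

theorem monotoneOn_realDigamma : MonotoneOn realDigamma (Set.Ioi 0) :=
  Real.convexOn_log_Gamma.monotoneOn_deriv fun _ hx => differentiableAt_log_Gamma hx

theorem realDigamma_le_log {x : ℝ} (hx : 0 < x) : realDigamma x ≤ Real.log x := by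
  have h := Real.convexOn_log_Gamma.deriv_le_slope (y := x + 1) (Set.mem_Ioi.2 hx)
    (Set.mem_Ioi.2 (by positivity)) (by linarith) (differentiableAt_log_Gamma hx)
  simpa [slope_def_field, log_Gamma_add_one hx] using! h

theorem log_le_realDigamma_add_one {x : ℝ} (hx : 0 < x) :
    Real.log x ≤ realDigamma (x + 1) := by
  have hx1 : 0 < x + 1 := by positivity
  have h := Real.convexOn_log_Gamma.slope_le_deriv (Set.mem_Ioi.2 hx)
    (Set.mem_Ioi.2 hx1) (by linarith) (differentiableAt_log_Gamma hx1)
  simpa [slope_def_field, log_Gamma_add_one hx] using! h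

open Filter Topology in
theorem tendsto_log_sub_sum_inv_realDigamma {x : ℝ} (hx : 0 < x) :
    Tendsto (fun N : ℕ => Real.log N - ∑ m ∈ Finset.range N, (x + m)⁻¹) atTop
      (𝓝 (realDigamma x)) := by
  have h (y : ℝ) : Tendsto (fun N : ℕ => Real.log (N + y) - Real.log N) atTop (𝓝 0) :=
    (Real.tendsto_log_comp_add_sub_log y).comp tendsto_natCast_atTop_atTop
  have h₀ : Tendsto (fun N : ℕ => realDigamma (x + N) - Real.log N) atTop (𝓝 0) := by
    refine tendsto_of_tendsto_of_tendsto_of_le_of_le' (h (x - 1)) (h x) ?_ ?_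
    · filter_upwards [eventually_ge_atTop 1] with N hN
      have hN' : (1 : ℝ) ≤ N := by exact_mod_cast hN
      have := log_le_realDigamma_add_one (x := N + (x - 1)) (by linarith)
      rw [show (N : ℝ) + (x - 1) + 1 = x + N by ring] at this
      linarith
    · filter_upwards with N
      have := realDigamma_le_log (x := x + N) (by positivity)
      rw [add_comm (N : ℝ)]
      linarith
  have h₁ := (tendsto_const_nhds (x := realDigamma x)).sub h₀
  rw [sub_zero] at h₁
  refine h₁.congr fun N => ?_
  rw [realDigamma_add_natCast hx]
  ring

theorem concaveOn_realDigamma : ConcaveOn ℝ (Set.Ioi 0) realDigamma := by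
  refine ⟨convex_Ioi 0, fun x hx y hy s t hs ht hst => ?_⟩
  have hz : 0 < s • x + t • y := convex_Ioi (0 : ℝ) hx hy hs ht hst
  refine le_of_tendsto_of_tendsto' (((tendsto_log_sub_sum_inv_realDigamma hx).const_smul s).add
    ((tendsto_log_sub_sum_inv_realDigamma hy).const_smul t))
    (tendsto_log_sub_sum_inv_realDigamma hz) fun N => ?_
  have key : ∑ m ∈ Finset.range N, (s • x + t • y + m)⁻¹ ≤
      s * ∑ m ∈ Finset.range N, (x + m)⁻¹ + t * ∑ m ∈ Finset.range N, (y + m)⁻¹ := by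
    rw [Finset.mul_sum, Finset.mul_sum, ← Finset.sum_add_distrib]
    refine Finset.sum_le_sum fun m _ => ?_
    have hxm : 0 < x + m := add_pos_of_pos_of_nonneg hx m.cast_nonneg
    have hym : 0 < y + m := add_pos_of_pos_of_nonneg hy m.cast_nonneg
    have h := (convexOn_zpow (𝕜 := ℝ) (-1)).2 hxm hym hs ht hst
    simp only [zpow_neg_one, smul_eq_mul] at h ⊢
    rwa [show s * (x + m) + t * (y + m) = s * x + t * y + m by
      linear_combination (m : ℝ) * hst] at h
  simp only [smul_eq_mul] at key ⊢
  linear_combination key + Real.log N * hst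

theorem strictMonoOn_realDigamma : StrictMonoOn realDigamma (Set.Ioi 0) := by
  intro x hx y hy hxy
  rw [Set.mem_Ioi] at hx hy
  have h := monotoneOn_realDigamma (a := x + 1) (b := y + 1) (Set.mem_Ioi.2 (by positivity))
    (Set.mem_Ioi.2 (by positivity)) (by linarith)
  rw [realDigamma_add_one hx, realDigamma_add_one hy] at h
  have := inv_strictAnti₀ hx hxy
  linarith

theorem deriv_realDigamma_le_slope {x y : ℝ} (hx : 0 < x) (hxy : x < y) :
    deriv realDigamma y ≤ slope realDigamma x y := by
  have hy : 0 < y := hx.trans hxy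
  by_cases hd : DifferentiableAt ℝ realDigamma y
  · exact concaveOn_realDigamma.deriv_le_slope hx hy hxy hd
  · rw [deriv_zero_of_not_differentiableAt hd, slope_def_field]
    exact div_nonneg (sub_nonneg.2 (monotoneOn_realDigamma hx hy hxy.le)) (sub_nonneg.2 hxy.le)

theorem sum_deriv_realDigamma_le {a : ℝ} (ha : 0 < a) {n : ℕ} (hn : 0 < n) (k : ℕ) :
    ∑ i ∈ Finset.Icc 1 k, deriv realDigamma (a + (i : ℝ) / n) ≤
      n * (realDigamma (a + (k : ℝ) / n) - realDigamma a) := by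
  have hn' : (0 : ℝ) < n := Nat.cast_pos.2 hn
  induction k with
  | zero => simp
  | succ k ih =>
    rw [Finset.sum_Icc_succ_top (by lia)]
    have hstep : a + ((k + 1 : ℕ) : ℝ) / n - (a + (k : ℝ) / n) = 1 / n := by
      push_cast
      ring
    have h := deriv_realDigamma_le_slope (x := a + (k : ℝ) / n)
      (y := a + ((k + 1 : ℕ) : ℝ) / n) (by positivity) (by gcongr; simp)
    rw [slope_def_field, hstep, div_div_eq_mul_div, div_one] at h
    linear_combination ih + h

/-- Riemann-sum inequality for the trigamma function `ψ₁ = (log Γ)″`: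
`Σ_{i=1}^{n−1} ψ₁(α + i/n) < n/α`. -/
theorem trigamma_sum_lt (n : ℕ) (hn : 2 ≤ n) (a : ℝ) (ha : 0 < a) :
    ∑ i ∈ Finset.Icc 1 (n - 1),
        iteratedDeriv 2 (fun t => Real.log (Real.Gamma t)) (a + (i : ℝ) / (n : ℝ))
      < (n : ℝ) / a := by
  have hn' : (0 : ℝ) < n := by positivity
  have hlt : a + ((n - 1 : ℕ) : ℝ) / n < a + 1 := by
    gcongr
    rw [div_lt_one hn', Nat.cast_lt]
    lia
  have h := strictMonoOn_realDigamma (Set.mem_Ioi.2 (by positivity))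
    (Set.mem_Ioi.2 (by positivity)) hlt
  rw [realDigamma_add_one ha] at h
  calc _ = ∑ i ∈ Finset.Icc 1 (n - 1), deriv realDigamma (a + (i : ℝ) / n) := by
        simp only [iteratedDeriv_succ, iteratedDeriv_zero]
        rfl
    _ ≤ n * (realDigamma (a + ((n - 1 : ℕ) : ℝ) / n) - realDigamma a) :=
        sum_deriv_realDigamma_le ha (by lia) _
    _ < n * a⁻¹ := by
        gcongr
        linarith
    _ = n / a := (div_eq_mul_inv _ _).symm
end
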